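/- arXiv:1606.02044 — 4 statements merged into one kernel-verified Lean document; each statement's English description precedes it below -/
import Mathlib

section
/- For every complex number s ≠ 1, the series Σ_{n=0}^∞ (1/(n+2)) Σ_{k=0}^n (−1)^k C(n,k) (k+1)^{−s} converges and its sum equals (s−1)·ζ(s), where ζ is the Riemann zeta function (Ser's globally convergent representation of the zeta function). -/
open Filter Finset

namespace SerZeta

open Asymptotics Topology Complex Set

/-- The inner alternating sum `Σ_{k ≤ n} (-1)^k C(n,k) (k+1)^{-s}` of Ser's series. -/
noncomputable def alternatingSum (n : ℕ) (s : ℂ) : ℂ :=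
  ∑ k ∈ Finset.range (n + 1), (-1) ^ k * (n.choose k : ℂ) * ((k : ℂ) + 1) ^ (-s)

lemma differentiable_alternatingSum (n : ℕ) : Differentiable ℂ (alternatingSum n) := by
  unfold alternatingSum
  refine Differentiable.fun_sum fun k _ ↦ (Differentiable.const_mul ?_ _)
  exact differentiable_neg.const_cpow (Or.inl (Nat.cast_add_one_ne_zero k))

lemma isBigO_exp_of_norm_le {f : ℝ → ℂ} {b : ℝ}
    (hf : ∀ t : ℝ, 0 < t → ‖f t‖ ≤ t ^ (-b) * Real.exp (-t / 2)) :
    f =O[atTop] fun t : ℝ ↦ Real.exp (-(1 / 4) * t) := by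
  have h1 : f =O[atTop] fun t : ℝ ↦ t ^ (-b) * Real.exp (-t / 2) :=
    IsBigO.of_norm_eventuallyLE <| by
      filter_upwards [eventually_gt_atTop 0] with t ht using hf t ht
  refine h1.trans ?_
  have h2 := (isLittleO_rpow_exp_pos_mul_atTop (-b) (b := 1 / 4) (by norm_num)).isBigO.mul
    (isBigO_refl (fun t : ℝ ↦ Real.exp (-t / 2)) atTop)
  refine h2.congr_right fun t ↦ ?_
  rw [← Real.exp_add]
  ring_nf

lemma isBigO_rpow_of_norm_le {f : ℝ → ℂ} {b : ℝ}
    (hf : ∀ t : ℝ, 0 < t → ‖f t‖ ≤ t ^ (-b) * Real.exp (-t / 2)) :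
    f =O[𝓝[>] 0] fun t : ℝ ↦ t ^ (-b) := by
  refine IsBigO.of_norm_eventuallyLE ?_
  filter_upwards [self_mem_nhdsWithin] with t ht
  have ht : 0 < t := ht
  refine (hf t ht).trans (mul_le_of_le_one_right (by positivity) ?_)
  exact Real.exp_le_one_iff.mpr (by linarith)

lemma mellinConvergent_of_norm_le {f : ℝ → ℂ} {b : ℝ} {s : ℂ} (hc : ContinuousOn f (Ioi 0))
    (hf : ∀ t : ℝ, 0 < t → ‖f t‖ ≤ t ^ (-b) * Real.exp (-t / 2)) (hs : b < s.re) :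
    MellinConvergent f s :=
  mellinConvergent_of_isBigO_rpow_exp (by norm_num) (hc.locallyIntegrableOn measurableSet_Ioi)
    (isBigO_exp_of_norm_le hf) (isBigO_rpow_of_norm_le hf) hs

lemma differentiableAt_mellin_of_norm_le {f : ℝ → ℂ} {b : ℝ} {s : ℂ}
    (hc : ContinuousOn f (Ioi 0))
    (hf : ∀ t : ℝ, 0 < t → ‖f t‖ ≤ t ^ (-b) * Real.exp (-t / 2)) (hs : b < s.re) :
    DifferentiableAt ℂ (mellin f) s :=
  mellin_differentiableAt_of_isBigO_rpow_exp (by norm_num)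
    (hc.locallyIntegrableOn measurableSet_Ioi)
    (isBigO_exp_of_norm_le hf) (isBigO_rpow_of_norm_le hf) hs

lemma one_sub_exp_neg_pos {t : ℝ} (ht : 0 < t) : 0 < 1 - Real.exp (-t) :=
  sub_pos.mpr (Real.exp_lt_one_iff.mpr (by linarith))

lemma one_sub_exp_neg_lt_one (t : ℝ) : 1 - Real.exp (-t) < 1 := by
  linarith [Real.exp_pos (-t)]

lemma one_sub_exp_neg_le (t : ℝ) : 1 - Real.exp (-t) ≤ t := by
  linarith [Real.add_one_le_exp (-t)]

lemma exp_neg_le_exp_neg_half {t : ℝ} (ht : 0 < t) : Real.exp (-t) ≤ Real.exp (-t / 2) :=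
  Real.exp_le_exp.mpr (by linarith)

lemma hasMellin_exp_neg_mul_pow (n : ℕ) {s : ℂ} (hs : 0 < s.re) :
    HasMellin (fun t : ℝ ↦ ((Real.exp (-t) * (1 - Real.exp (-t)) ^ n : ℝ) : ℂ)) s
      (Gamma s * alternatingSum n s) := by
  constructor
  · refine mellinConvergent_of_norm_le (b := 0) (by fun_prop) (fun t ht ↦ ?_) hs
    have h0 := one_sub_exp_neg_pos ht
    rw [norm_real, Real.norm_of_nonneg (by positivity), neg_zero, Real.rpow_zero, one_mul]
    exact (mul_le_of_le_one_right (Real.exp_pos _).le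
      (pow_le_one₀ h0.le (one_sub_exp_neg_lt_one t).le)).trans (exp_neg_le_exp_neg_half ht)
  · have h := hasSum_mellin (ι := Fin (n + 1)) (s := s)
      (a := fun k ↦ (-1) ^ (k : ℕ) * (n.choose k : ℂ)) (p := fun k ↦ (k : ℝ) + 1)
      (F := fun t : ℝ ↦ ((Real.exp (-t) * (1 - Real.exp (-t)) ^ n : ℝ) : ℂ))
      (fun k ↦ Or.inr (by positivity)) hs (fun t _ ↦ ?_) (hasSum_fintype _).summable
    · rw [h.unique (hasSum_fintype _), alternatingSum, Finset.sum_range, Finset.mul_sum]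
      refine Finset.sum_congr rfl fun k _ ↦ ?_
      push_cast
      rw [cpow_neg]
      ring
    · convert hasSum_fintype _ using 1
      rw [← Finset.sum_range (f := fun k : ℕ ↦
        (-1) ^ k * (n.choose k : ℂ) * (Real.exp (-((k : ℝ) + 1) * t) : ℂ)), sub_eq_neg_add,
        add_pow, Finset.mul_sum]
      push_cast
      refine Finset.sum_congr rfl fun k _ ↦ ?_
      rw [neg_pow, ← Complex.exp_nat_mul, one_pow,
        show -((k : ℂ) + 1) * t = -t + k * -t by ring, Complex.exp_add]
      ring

/-- The kernel `Σ_{n < N} e^{-t} (1 - e^{-t})^n / (n + 2)` of a partial sum of Ser's series. -/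
noncomputable def partialKernel (N : ℕ) (t : ℝ) : ℝ :=
  ∑ n ∈ Finset.range N, Real.exp (-t) * (1 - Real.exp (-t)) ^ n / (n + 2)

/-- The partial sums of Ser's series. -/
noncomputable def partialSum (N : ℕ) (s : ℂ) : ℂ :=
  ∑ n ∈ Finset.range N, (1 / ((n : ℂ) + 2)) * alternatingSum n s

lemma hasMellin_partialKernel (N : ℕ) {s : ℂ} (hs : 0 < s.re) :
    HasMellin (fun t ↦ (partialKernel N t : ℂ)) s (Gamma s * partialSum N s) := by
  induction N with
  | zero => simp [partialKernel, partialSum, HasMellin, MellinConvergent, mellin]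
  | succ N ih =>
    have h1 := hasMellin_exp_neg_mul_pow N hs
    have h2 := hasMellin_const_smul h1.1 (1 / ((N : ℂ) + 2))
    have h3 := hasMellin_add ih.1 h2.1
    rw [ih.2, h2.2, h1.2] at h3
    convert! h3 using 1
    · funext t
      rw [partialKernel, Finset.sum_range_succ, ← partialKernel]
      push_cast
      rw [smul_eq_mul]
      ring
    · rw [partialSum, Finset.sum_range_succ, ← partialSum, smul_eq_mul]
      ring

/-- The kernel of the remainder of Ser's series after `N` terms. -/
noncomputable def tailKernel (N : ℕ) (t : ℝ) : ℝ :=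
  Real.exp (-t) * (t - (1 - Real.exp (-t))) / (1 - Real.exp (-t)) ^ 2 - partialKernel N t

lemma continuousOn_tailKernel (N : ℕ) :
    ContinuousOn (fun t ↦ (tailKernel N t : ℂ)) (Ioi 0) := by
  refine continuous_ofReal.comp_continuousOn (ContinuousOn.sub ?_ ?_)
  · refine ContinuousOn.div (by fun_prop) (by fun_prop) fun t ht ↦ ?_
    exact pow_ne_zero _ (one_sub_exp_neg_pos ht).ne'
  · unfold partialKernel
    fun_prop

lemma hasSum_tailKernel (N : ℕ) {t : ℝ} (ht : 0 < t) :
    HasSum (fun n : ℕ ↦ Real.exp (-t) * (1 - Real.exp (-t)) ^ (n + N) / ((n + N : ℕ) + 2))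
      (tailKernel N t) := by
  have h0 := one_sub_exp_neg_pos ht
  have h1 := Real.hasSum_pow_div_log_of_abs_lt_one (x := 1 - Real.exp (-t))
    (by rw [abs_of_pos h0]; exact one_sub_exp_neg_lt_one t)
  rw [sub_sub_cancel, Real.log_exp, neg_neg] at h1
  have h2 := (((hasSum_nat_add_iff' 1).mpr h1).mul_left
    (Real.exp (-t) / (1 - Real.exp (-t)) ^ 2))
  have h3 : HasSum (fun n : ℕ ↦ Real.exp (-t) * (1 - Real.exp (-t)) ^ n / ((n : ℝ) + 2))
      (Real.exp (-t) * (t - (1 - Real.exp (-t))) / (1 - Real.exp (-t)) ^ 2) := by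
    convert! h2 using 1
    · funext n
      push_cast
      field_simp
      ring
    · simp
      ring
  exact (hasSum_nat_add_iff' N).mpr h3

lemma tailKernel_nonneg (N : ℕ) {t : ℝ} (ht : 0 < t) : 0 ≤ tailKernel N t := by
  have h0 := one_sub_exp_neg_pos ht
  exact (hasSum_tailKernel N ht).nonneg fun n ↦ by positivity

lemma tailKernel_succ_le (N : ℕ) {t : ℝ} (ht : 0 < t) :
    tailKernel (N + 1) t ≤ Real.exp (-t) * (1 - Real.exp (-t)) ^ N * t := by
  have h0 := one_sub_exp_neg_pos ht
  have h1 := Real.hasSum_pow_div_log_of_abs_lt_one (x := 1 - Real.exp (-t))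
    (by rw [abs_of_pos h0]; exact one_sub_exp_neg_lt_one t)
  rw [sub_sub_cancel, Real.log_exp, neg_neg] at h1
  refine hasSum_le (fun n ↦ ?_) (hasSum_tailKernel (N + 1) ht)
    (h1.mul_left (Real.exp (-t) * (1 - Real.exp (-t)) ^ N))
  rw [← mul_div_assoc, mul_assoc, ← pow_add, show N + (n + 1) = n + (N + 1) by ring]
  gcongr
  · linarith [(Nat.cast_nonneg N : (0 : ℝ) ≤ N)]
  · norm_num

lemma norm_tailKernel_succ_le {M N : ℕ} (hMN : M ≤ N) {t : ℝ} (ht : 0 < t) :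
    ‖(tailKernel (N + 1) t : ℂ)‖ ≤ t ^ (-(-((M : ℝ) + 1))) * Real.exp (-t / 2) := by
  have h0 := one_sub_exp_neg_pos ht
  rw [norm_real, Real.norm_of_nonneg (tailKernel_nonneg _ ht), neg_neg]
  norm_cast
  calc tailKernel (N + 1) t ≤ Real.exp (-t) * (1 - Real.exp (-t)) ^ N * t :=
        tailKernel_succ_le N ht
    _ ≤ Real.exp (-t / 2) * t ^ M * t := by
        gcongr
        · linarith
        · exact (pow_le_pow_of_le_one h0.le (one_sub_exp_neg_lt_one t).le hMN).trans
            (pow_le_pow_left₀ h0.le (one_sub_exp_neg_le t) M)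
    _ = t ^ (M + 1) * Real.exp (-t / 2) := by ring

lemma tendsto_tailKernel {t : ℝ} (ht : 0 < t) :
    Tendsto (fun N ↦ tailKernel (N + 1) t) atTop (𝓝 0) := by
  refine squeeze_zero (fun N ↦ tailKernel_nonneg _ ht) (fun N ↦ tailKernel_succ_le N ht) ?_
  have h := tendsto_pow_atTop_nhds_zero_of_lt_one (one_sub_exp_neg_pos ht).le
    (one_sub_exp_neg_lt_one t)
  simpa using (h.const_mul (Real.exp (-t))).mul_const t

lemma tendsto_mellin_tailKernel (s : ℂ) :
    Tendsto (fun N ↦ mellin (fun t ↦ (tailKernel (N + 1) t : ℂ)) s) atTop (𝓝 0) := by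
  obtain ⟨M, hM⟩ := exists_nat_gt (-s.re)
  have hb : MellinConvergent (fun t : ℝ ↦ ((t ^ (M + 1) * Real.exp (-t / 2) : ℝ) : ℂ)) s := by
    refine mellinConvergent_of_norm_le (b := -((M : ℝ) + 1)) (by fun_prop) (fun t ht ↦ ?_)
      (by linarith)
    rw [norm_real, Real.norm_of_nonneg (by positivity), neg_neg]
    norm_cast
  rw [← MeasureTheory.integral_zero ℝ ℂ (μ := MeasureTheory.volume.restrict (Ioi 0))]
  refine MeasureTheory.tendsto_integral_filter_of_dominated_convergence _ ?_ ?_ hb.norm ?_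
  · filter_upwards [eventually_ge_atTop M] with N hN
    refine (mellinConvergent_of_norm_le (continuousOn_tailKernel (N + 1))
      (fun t ht ↦ norm_tailKernel_succ_le hN ht) ?_ : MellinConvergent _ s).aestronglyMeasurable
    linarith [(Nat.cast_le (α := ℝ)).mpr hN]
  · filter_upwards [eventually_ge_atTop M] with N hN
    filter_upwards [MeasureTheory.ae_restrict_mem measurableSet_Ioi] with t ht
    have ht : 0 < t := ht
    rw [norm_smul, norm_smul]
    gcongr
    refine (norm_tailKernel_succ_le hN ht).trans_eq ?_
    rw [norm_real, Real.norm_of_nonneg (by positivity), neg_neg]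
    norm_cast
  · filter_upwards [MeasureTheory.ae_restrict_mem measurableSet_Ioi] with t ht
    have h := ((continuous_ofReal.tendsto 0).comp (tendsto_tailKernel ht)).const_smul
      ((t : ℂ) ^ (s - 1))
    simpa using h

lemma summable_one_div_nat_add_one_rpow {σ : ℝ} (hσ : 1 < σ) :
    Summable fun n : ℕ ↦ 1 / ((n : ℝ) + 1) ^ σ := by
  simpa using (summable_nat_add_iff 1).mpr (Real.summable_one_div_nat_rpow.mpr hσ)

lemma hasMellin_exp_neg_div {s : ℂ} (hs : 1 < s.re) :
    HasMellin (fun t : ℝ ↦ ((Real.exp (-t) / (1 - Real.exp (-t)) : ℝ) : ℂ)) s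
      (Gamma s * riemannZeta s) := by
  constructor
  · refine mellinConvergent_of_norm_le (b := 1) ?_ (fun t ht ↦ ?_) hs
    · refine continuous_ofReal.comp_continuousOn (ContinuousOn.div (by fun_prop) (by fun_prop) ?_)
      exact fun t ht ↦ (one_sub_exp_neg_pos ht).ne'
    · have h0 := one_sub_exp_neg_pos ht
      rw [norm_real, Real.norm_of_nonneg (by positivity), Real.rpow_neg_one, div_le_iff₀ h0]
      have h1 : Real.exp (-t) = Real.exp (-t / 2) * Real.exp (-t / 2) := by
        rw [← Real.exp_add]; ring_nf
      have h2 : Real.exp (-t / 2) * Real.exp (t / 2) = 1 := by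
        rw [← Real.exp_add]; ring_nf; exact Real.exp_zero
      have h3 : t / 2 < Real.sinh (t / 2) := Real.self_lt_sinh_iff.mpr (by linarith)
      rw [Real.sinh_eq, show -(t / 2) = -t / 2 by ring] at h3
      have h4 := Real.exp_pos (-t / 2)
      rw [h1]
      have h5 : 1 - Real.exp (-t / 2) * Real.exp (-t / 2) =
          Real.exp (-t / 2) * (Real.exp (t / 2) - Real.exp (-t / 2)) := by
        rw [mul_sub, h2]
      rw [h5, mul_assoc, ← mul_assoc (Real.exp (-t / 2)), mul_comm (t⁻¹), ← div_eq_mul_inv,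
        le_div_iff₀ ht, mul_assoc]
      nlinarith [mul_pos h4 h4]
  · have h := hasSum_mellin (ι := ℕ) (s := s) (a := fun _ ↦ 1) (p := fun k ↦ (k : ℝ) + 1)
      (F := fun t : ℝ ↦ ((Real.exp (-t) / (1 - Real.exp (-t)) : ℝ) : ℂ))
      (fun k ↦ Or.inr (by positivity)) (by linarith) (fun t ht ↦ ?_)
      (by simpa using summable_one_div_nat_add_one_rpow hs)
    · rw [← h.tsum_eq, zeta_eq_tsum_one_div_nat_add_one_cpow hs, ← tsum_mul_left]
      congr 1 with k
      push_cast
      ring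
    · have ht : 0 < t := ht
      have h1 := (hasSum_geometric_of_lt_one (Real.exp_pos (-t)).le
        (sub_pos.mp (one_sub_exp_neg_pos ht))).mul_left (Real.exp (-t))
      rw [← div_eq_mul_inv] at h1
      convert! hasSum_ofReal.mpr h1 using 2 with k
      rw [one_mul, ← Real.exp_nat_mul, ← Real.exp_add]
      ring_nf

lemma mellin_mul_exp_neg_div_sq {s : ℂ} (hs : 1 < s.re) :
    mellin (fun t : ℝ ↦ ((t * (Real.exp (-t) / (1 - Real.exp (-t)) ^ 2) : ℝ) : ℂ)) s =
      s * Gamma s * riemannZeta s := by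
  have h := hasSum_mellin (ι := ℕ) (s := s + 1) (a := fun k ↦ (k : ℂ) + 1)
      (p := fun k ↦ (k : ℝ) + 1)
      (F := fun t : ℝ ↦ ((Real.exp (-t) / (1 - Real.exp (-t)) ^ 2 : ℝ) : ℂ))
      (fun k ↦ Or.inr (by positivity)) (by simp; linarith) (fun t ht ↦ ?_) ?_
  · have h1 := mellin_cpow_smul
      (fun t : ℝ ↦ ((Real.exp (-t) / (1 - Real.exp (-t)) ^ 2 : ℝ) : ℂ)) s 1
    simp only [cpow_one, smul_eq_mul, ← ofReal_mul] at h1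
    rw [h1, ← h.tsum_eq, zeta_eq_tsum_one_div_nat_add_one_cpow hs, ← tsum_mul_left,
      Complex.Gamma_add_one s (by rintro rfl; simp at hs; linarith)]
    congr 1 with k
    have hk : (k : ℂ) + 1 ≠ 0 := Nat.cast_add_one_ne_zero k
    push_cast
    rw [cpow_add _ _ hk, cpow_one]
    field_simp
  · have ht : 0 < t := ht
    have h0 := one_sub_exp_neg_pos ht
    have h2 := hasSum_coe_mul_geometric_of_norm_lt_one (r := Real.exp (-t))
        (by rw [Real.norm_of_nonneg (Real.exp_pos _).le]; linarith)
    have h3 := (hasSum_nat_add_iff' 1).mpr h2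
    simp only [Finset.sum_range_one, Nat.cast_zero, zero_mul, sub_zero] at h3
    convert! hasSum_ofReal.mpr h3 using 2 with k
    push_cast
    rw [← Complex.exp_nat_mul]
    push_cast
    ring_nf
  · refine (summable_one_div_nat_add_one_rpow hs).congr fun k ↦ ?_
    have hk : (0 : ℝ) < (k : ℝ) + 1 := by positivity
    have h1 : ‖(k : ℂ) + 1‖ = (k : ℝ) + 1 := by
      exact_mod_cast norm_natCast (k + 1)
    rw [h1, add_re, one_re, Real.rpow_add hk, Real.rpow_one]
    field_simp

lemma partialSum_add_mellin_tailKernel_of_one_lt_re (N : ℕ) {s : ℂ} (hs : 1 < s.re) :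
    partialSum (N + 1) s + (Gamma s)⁻¹ * mellin (fun t ↦ (tailKernel (N + 1) t : ℂ)) s =
      (s - 1) * riemannZeta s := by
  have hG : Gamma s ≠ 0 := Gamma_ne_zero_of_re_pos (by linarith)
  have h1 := hasMellin_partialKernel (N + 1) (s := s) (by linarith)
  have h2 := hasMellin_exp_neg_div hs
  have h3 : MellinConvergent (fun t ↦ (tailKernel (N + 1) t : ℂ)) s :=
    mellinConvergent_of_norm_le (continuousOn_tailKernel (N + 1))
      (fun t ht ↦ norm_tailKernel_succ_le le_rfl ht)
      (by linarith [(Nat.cast_nonneg N : (0 : ℝ) ≤ N)])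
  have h4 := hasMellin_add h1.1 h3
  have h5 := hasMellin_add h4.1 h2.1
  have h6 := h5.2
  rw [h4.2, h1.2, h2.2] at h6
  have h7 : mellin (fun t : ℝ ↦ ((t * (Real.exp (-t) / (1 - Real.exp (-t)) ^ 2) : ℝ) : ℂ)) s =
      mellin (fun t : ℝ ↦ (partialKernel (N + 1) t : ℂ) + (tailKernel (N + 1) t : ℂ) +
        ((Real.exp (-t) / (1 - Real.exp (-t)) : ℝ) : ℂ)) s := by
    refine MeasureTheory.setIntegral_congr_fun measurableSet_Ioi fun t ht ↦ ?_
    have h0 := one_sub_exp_neg_pos ht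
    simp only [← ofReal_add]
    congr 2
    rw [tailKernel]
    field_simp
    ring
  rw [← h7, mellin_mul_exp_neg_div_sq hs] at h6
  field_simp
  linear_combination -h6

/-- The function `(s - 1) ζ(s)` extends to an entire function. -/
lemma differentiable_update_sub_one_mul_riemannZeta :
    Differentiable ℂ (Function.update (fun s ↦ (s - 1) * riemannZeta s) 1 1) := by
  rw [← differentiableOn_univ,
    ← differentiableOn_compl_singleton_and_continuousAt_iff (c := 1) univ_mem]
  constructor
  · intro s hs
    have hs : s ≠ 1 := hs.2
    refine DifferentiableAt.differentiableWithinAt ?_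
    refine DifferentiableAt.congr_of_eventuallyEq (f := fun s ↦ (s - 1) * riemannZeta s)
      ((by fun_prop : DifferentiableAt ℂ (fun s : ℂ ↦ s - 1) s).mul
        (differentiableAt_riemannZeta hs)) ?_
    filter_upwards [isOpen_compl_singleton.mem_nhds hs] with z hz
    rw [Function.update_of_ne hz]
  · exact continuousAt_update_same.mpr riemannZeta_residue_one

lemma partialSum_add_mellin_tailKernel (N : ℕ) {s : ℂ} (hs : -((N : ℝ) + 1) < s.re)
    (hs1 : s ≠ 1) :
    partialSum (N + 1) s + (Gamma s)⁻¹ * mellin (fun t ↦ (tailKernel (N + 1) t : ℂ)) s =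
      (s - 1) * riemannZeta s := by
  have hU : IsOpen {z : ℂ | -((N : ℝ) + 1) < z.re} := isOpen_lt continuous_const continuous_re
  have h1 : DifferentiableOn ℂ (fun z ↦ partialSum (N + 1) z +
      (Gamma z)⁻¹ * mellin (fun t ↦ (tailKernel (N + 1) t : ℂ)) z)
      {z : ℂ | -((N : ℝ) + 1) < z.re} := by
    intro z hz
    refine DifferentiableAt.differentiableWithinAt (.add ?_ (.mul ?_ ?_))
    · exact DifferentiableAt.fun_sum fun n _ ↦
        (differentiable_alternatingSum n z).const_mul _
    · exact differentiable_one_div_Gamma z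
    · exact differentiableAt_mellin_of_norm_le (continuousOn_tailKernel (N + 1))
        (fun t ht ↦ norm_tailKernel_succ_le le_rfl ht) hz
  have h2 := (h1.analyticOnNhd hU).eqOn_of_preconnected_of_eventuallyEq
    (differentiable_update_sub_one_mul_riemannZeta.differentiableOn.analyticOnNhd hU)
    (convex_halfSpace_re_gt _).isPreconnected (z₀ := 2)
    (by simp; linarith [(Nat.cast_nonneg N : (0 : ℝ) ≤ N)]) ?_
  · have h3 := h2 hs
    rwa [Function.update_of_ne hs1] at h3
  · filter_upwards [(isOpen_lt continuous_const continuous_re).mem_nhds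
      (show (1 : ℝ) < (2 : ℂ).re by simp)] with z hz
    rw [Function.update_of_ne (by rintro rfl; simp at hz)]
    exact partialSum_add_mellin_tailKernel_of_one_lt_re N hz

end SerZeta

/-- Ser's globally convergent representation of the Riemann zeta function:
for every `s ≠ 1`, the series `Σ_{n=0}^∞ (1/(n+2)) Σ_{k=0}^n (−1)^k C(n,k) (k+1)^{−s}`
converges (in the sense of partial sums) to `(s−1)·ζ(s)`. -/
theorem ser_representation_zeta (s : ℂ) (hs : s ≠ 1) :
    Tendsto (fun N : ℕ => ∑ n ∈ Finset.range N, (1 / ((n : ℂ) + 2)) *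
        ∑ k ∈ Finset.range (n + 1), (-1) ^ k * (n.choose k : ℂ) * ((k : ℂ) + 1) ^ (-s))
      atTop (nhds ((s - 1) * riemannZeta s)) := by
  change Tendsto (fun N ↦ SerZeta.partialSum N s) atTop _
  rw [← tendsto_add_atTop_iff_nat 1]
  have h := ((SerZeta.tendsto_mellin_tailKernel s).const_mul (Complex.Gamma s)⁻¹).const_sub
    ((s - 1) * riemannZeta s)
  rw [mul_zero, sub_zero] at h
  refine h.congr' ?_
  obtain ⟨M, hM⟩ := exists_nat_gt (-s.re)
  filter_upwards [eventually_ge_atTop M] with N hN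
  have hMN : (M : ℝ) ≤ N := Nat.cast_le.mpr hN
  rw [← SerZeta.partialSum_add_mellin_tailKernel N (by linarith) hs, add_sub_cancel_right]
end

section
/- For every complex number s ≠ 1, the series Σ_{n=0}^∞ (1/(n+1)) Σ_{k=0}^n (−1)^k C(n,k) (k+1)^{1−s} converges and its sum equals (s−1)·ζ(s), where ζ is the Riemann zeta function (Hasse's globally convergent representation of the zeta function). -/
open Filter Finset

open Topology Asymptotics

/-- The `N`-th tail of the power series of `-log (1 - x) / x` at `x = 1 - exp (-t)`,
weighted by `exp (-t)`. -/
noncomputable def hasseTail (N : ℕ) (t : ℝ) : ℝ :=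
  Real.exp (-t) * (t / (1 - Real.exp (-t)) -
    ∑ n ∈ range N, (1 - Real.exp (-t)) ^ n / ((n : ℝ) + 1))

lemma one_sub_exp_neg_pos {t : ℝ} (ht : 0 < t) : 0 < 1 - Real.exp (-t) := by
  simpa using ht

lemma one_sub_exp_neg_lt_one (t : ℝ) : 1 - Real.exp (-t) < 1 := by
  linarith [Real.exp_pos (-t)]

lemma hasSum_one_sub_exp_neg_pow_div {t : ℝ} (ht : 0 < t) :
    HasSum (fun n : ℕ => (1 - Real.exp (-t)) ^ n / ((n : ℝ) + 1)) (t / (1 - Real.exp (-t))) := by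
  have hx := one_sub_exp_neg_pos ht
  have h := (Real.hasSum_pow_div_log_of_abs_lt_one (x := 1 - Real.exp (-t))
    (by rw [abs_of_pos hx]; exact one_sub_exp_neg_lt_one t)).div_const (1 - Real.exp (-t))
  rw [sub_sub_cancel, Real.log_exp, neg_neg] at h
  refine h.congr_fun fun n => ?_
  field_simp
  ring

lemma hasseTail_nonneg (N : ℕ) {t : ℝ} (ht : 0 < t) : 0 ≤ hasseTail N t := by
  have hx := one_sub_exp_neg_pos ht
  refine mul_nonneg (Real.exp_pos _).le (sub_nonneg.mpr ?_)
  exact sum_le_hasSum _ (fun n _ => by positivity) (hasSum_one_sub_exp_neg_pow_div ht)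

lemma hasseTail_le (N : ℕ) {t : ℝ} (ht : 0 < t) :
    hasseTail N t ≤ 2 * Real.exp (-(1 / 2) * t) * (1 - Real.exp (-t)) ^ N := by
  have hx := one_sub_exp_neg_pos ht
  have hs := hasSum_one_sub_exp_neg_pow_div ht
  set x := 1 - Real.exp (-t) with hxdef
  have h1 : t / x - ∑ n ∈ range N, x ^ n / ((n : ℝ) + 1) ≤ x ^ N * (t / x) := by
    refine hasSum_le (fun n => ?_) ((hasSum_nat_add_iff' N).mpr hs) (hs.mul_left (x ^ N))
    rw [← mul_div_assoc, ← pow_add, add_comm N]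
    gcongr
    simp
  have h2 : t / x ≤ 1 + t := by
    rw [div_le_iff₀ hx]
    have h3 : Real.exp (-t) * (1 + t) ≤ 1 := by
      calc Real.exp (-t) * (1 + t) ≤ Real.exp (-t) * Real.exp t := by
            gcongr; linarith [Real.add_one_le_exp t]
        _ = 1 := by rw [← Real.exp_add]; simp
    rw [hxdef]; linarith
  have h3 : Real.exp (-t) * (1 + t) ≤ 2 * Real.exp (-(1 / 2) * t) := by
    calc Real.exp (-t) * (1 + t) ≤ Real.exp (-t) * (2 * Real.exp (1 / 2 * t)) := by
          gcongr; linarith [Real.add_one_le_exp (1 / 2 * t)]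
      _ = 2 * Real.exp (-(1 / 2) * t) := by
          rw [mul_left_comm, ← Real.exp_add]; ring_nf
  calc hasseTail N t ≤ Real.exp (-t) * (x ^ N * (1 + t)) := by
        unfold hasseTail
        gcongr
        exact h1.trans (by gcongr)
    _ = (Real.exp (-t) * (1 + t)) * x ^ N := by ring
    _ ≤ _ := by gcongr

lemma continuousOn_hasseTail (N : ℕ) : ContinuousOn (hasseTail N) (Set.Ioi 0) := by
  unfold hasseTail
  refine ContinuousOn.mul (by fun_prop) (ContinuousOn.sub (ContinuousOn.div (by fun_prop)
    (by fun_prop) fun t ht => (one_sub_exp_neg_pos ht).ne') (by fun_prop))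

lemma hasseTail_succ (N : ℕ) (t : ℝ) :
    hasseTail (N + 1) t =
      hasseTail N t - 1 / ((N : ℝ) + 1) * (Real.exp (-t) * (1 - Real.exp (-t)) ^ N) := by
  simp only [hasseTail, sum_range_succ]
  ring

lemma antitone_hasseTail {t : ℝ} (ht : 0 < t) : Antitone (fun N => hasseTail N t) := by
  refine antitone_nat_of_succ_le fun N => ?_
  have hx := one_sub_exp_neg_pos ht
  rw [hasseTail_succ]
  exact sub_le_self _ (by positivity)

lemma tendsto_hasseTail {t : ℝ} (ht : 0 < t) :
    Tendsto (fun N => hasseTail N t) atTop (𝓝 0) := by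
  have hx := one_sub_exp_neg_pos ht
  refine squeeze_zero (fun N => hasseTail_nonneg N ht) (fun N => hasseTail_le N ht) ?_
  simpa using (tendsto_pow_atTop_nhds_zero_of_lt_one hx.le
    (one_sub_exp_neg_lt_one t)).const_mul (2 * Real.exp (-(1 / 2) * t))

lemma locallyIntegrableOn_hasseTail (N : ℕ) :
    MeasureTheory.LocallyIntegrableOn (fun t => (hasseTail N t : ℂ)) (Set.Ioi 0) :=
  (Complex.continuous_ofReal.comp_continuousOn (continuousOn_hasseTail N)).locallyIntegrableOn
    measurableSet_Ioi

lemma isBigO_hasseTail_atTop (N : ℕ) :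
    (fun t => (hasseTail N t : ℂ)) =O[atTop] fun t => Real.exp (-(1 / 2) * t) := by
  refine IsBigO.of_bound 2 ?_
  filter_upwards [eventually_gt_atTop 0] with t ht
  have hx := one_sub_exp_neg_pos ht
  rw [Complex.norm_real, Real.norm_of_nonneg (hasseTail_nonneg N ht),
    Real.norm_of_nonneg (Real.exp_pos _).le]
  exact (hasseTail_le N ht).trans (mul_le_of_le_one_right (by positivity)
    (pow_le_one₀ hx.le (one_sub_exp_neg_lt_one t).le))

lemma isBigO_hasseTail_zero (N : ℕ) :
    (fun t => (hasseTail N t : ℂ)) =O[𝓝[>] 0] fun t : ℝ => t ^ (-(-(N : ℝ))) := by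
  refine IsBigO.of_bound 2 ?_
  filter_upwards [self_mem_nhdsWithin] with t (ht : 0 < t)
  have hx := one_sub_exp_neg_pos ht
  rw [Complex.norm_real, Real.norm_of_nonneg (hasseTail_nonneg N ht), neg_neg, Real.rpow_natCast,
    Real.norm_of_nonneg (by positivity)]
  refine (hasseTail_le N ht).trans ?_
  have h1 : Real.exp (-(1 / 2) * t) ≤ 1 := Real.exp_le_one_iff.mpr (by linarith)
  have h2 : 1 - Real.exp (-t) ≤ t := by linarith [Real.add_one_le_exp (-t)]
  calc _ ≤ 2 * 1 * t ^ N := by gcongr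
    _ = _ := by ring

lemma mellinConvergent_hasseTail {N : ℕ} {s : ℂ} (hs : -(N : ℝ) < s.re) :
    MellinConvergent (fun t => (hasseTail N t : ℂ)) s :=
  mellinConvergent_of_isBigO_rpow_exp one_half_pos (locallyIntegrableOn_hasseTail N)
    (isBigO_hasseTail_atTop N) (isBigO_hasseTail_zero N) hs

lemma differentiableAt_mellin_hasseTail {N : ℕ} {s : ℂ} (hs : -(N : ℝ) < s.re) :
    DifferentiableAt ℂ (mellin (fun t => (hasseTail N t : ℂ))) s :=
  mellin_differentiableAt_of_isBigO_rpow_exp one_half_pos (locallyIntegrableOn_hasseTail N)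
    (isBigO_hasseTail_atTop N) (isBigO_hasseTail_zero N) hs

lemma tendsto_mellin_hasseTail (s : ℂ) :
    Tendsto (fun N => mellin (fun t => (hasseTail N t : ℂ)) s) atTop (𝓝 0) := by
  obtain ⟨m, hm⟩ := exists_nat_gt (-s.re)
  have hm' : -(m : ℝ) < s.re := by linarith
  have hlim := MeasureTheory.tendsto_integral_filter_of_dominated_convergence
    (μ := MeasureTheory.volume.restrict (Set.Ioi (0 : ℝ))) (l := atTop)
    (F := fun (N : ℕ) (t : ℝ) => (t : ℂ) ^ (s - 1) • (hasseTail N t : ℂ)) (f := fun _ => 0)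
    (fun t => ‖(t : ℂ) ^ (s - 1) • (hasseTail m t : ℂ)‖) ?_ ?_
    (mellinConvergent_hasseTail hm').norm ?_
  · simpa [mellin] using hlim
  · filter_upwards [eventually_ge_atTop m] with N hN
    refine (mellinConvergent_hasseTail (N := N) ?_).aestronglyMeasurable
    have : (m : ℝ) ≤ N := by exact_mod_cast hN
    linarith
  · filter_upwards [eventually_ge_atTop m] with N hN
    filter_upwards [MeasureTheory.ae_restrict_mem measurableSet_Ioi] with t ht
    rw [norm_smul, norm_smul, Complex.norm_real, Complex.norm_real,
      Real.norm_of_nonneg (hasseTail_nonneg N ht), Real.norm_of_nonneg (hasseTail_nonneg m ht)]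
    gcongr
    exact antitone_hasseTail ht hN
  · filter_upwards [MeasureTheory.ae_restrict_mem measurableSet_Ioi] with t ht
    simpa using ((Complex.continuous_ofReal.tendsto 0).comp (tendsto_hasseTail ht)).const_mul
      ((t : ℂ) ^ (s - 1))

lemma hasMellin_exp_neg_mul_one_sub_exp_neg_pow (n : ℕ) {s : ℂ} (hs : 0 < s.re) :
    HasMellin (fun t : ℝ => ((Real.exp (-t) * (1 - Real.exp (-t)) ^ n : ℝ) : ℂ)) s
      (Complex.Gamma s *
        ∑ k ∈ range (n + 1), (-1) ^ k * (n.choose k : ℂ) * ((k : ℂ) + 1) ^ (-s)) := by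
  constructor
  · refine mellinConvergent_of_isBigO_rpow_exp (a := 1) (b := 0) one_pos
      ((by fun_prop : Continuous _).locallyIntegrable.locallyIntegrableOn _) ?_ ?_ hs
    · refine IsBigO.of_bound 1 ?_
      filter_upwards [eventually_gt_atTop 0] with t ht
      have hx := one_sub_exp_neg_pos ht
      rw [Complex.norm_real, Real.norm_of_nonneg (by positivity),
        Real.norm_of_nonneg (Real.exp_pos _).le, one_mul, neg_one_mul]
      exact mul_le_of_le_one_right (Real.exp_pos _).le
        (pow_le_one₀ hx.le (one_sub_exp_neg_lt_one t).le)
    · simp only [neg_zero, Real.rpow_zero]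
      exact ((by fun_prop : Continuous fun t : ℝ =>
        ((Real.exp (-t) * (1 - Real.exp (-t)) ^ n : ℝ) : ℂ)).continuousAt.isBigO_one ℝ).mono
        nhdsWithin_le_nhds
  · have h := hasSum_mellin (ι := range (n + 1))
      (a := fun k => (-1) ^ (k : ℕ) * (n.choose k : ℂ)) (p := fun k => (k : ℕ) + 1)
      (F := fun t : ℝ => ((Real.exp (-t) * (1 - Real.exp (-t)) ^ n : ℝ) : ℂ)) (s := s)
      (fun k => .inr (by positivity)) hs ?_ .of_finite
    · rw [← h.tsum_eq, tsum_fintype, mul_sum, ← sum_coe_sort (range (n + 1))]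
      refine sum_congr rfl fun k _ => ?_
      rw [Complex.cpow_neg]
      push_cast
      ring
    · intro t _
      have hsum := hasSum_fintype fun k : range (n + 1) =>
        (-1) ^ (k : ℕ) * (n.choose k : ℂ) * (Real.exp (-((k : ℕ) + 1) * t) : ℂ)
      rw [sum_coe_sort (range (n + 1)) fun k : ℕ =>
        (-1) ^ k * (n.choose k : ℂ) * (Real.exp (-((k : ℕ) + 1) * t) : ℂ)] at hsum
      convert hsum using 1
      have hb : (1 - Real.exp (-t)) ^ n =
          ∑ k ∈ range (n + 1), (-1) ^ k * (n.choose k : ℝ) * Real.exp (-(k : ℝ) * t) := by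
        rw [sub_eq_neg_add, add_pow]
        refine sum_congr rfl fun k _ => ?_
        rw [neg_pow, ← Real.exp_nat_mul]
        ring_nf
      rw [hb, mul_sum]
      push_cast
      refine sum_congr rfl fun k _ => ?_
      rw [mul_left_comm, ← Complex.exp_add]
      ring_nf

lemma mellin_hasseTail_zero {s : ℂ} (hs : 1 < s.re) :
    mellin (fun t => (hasseTail 0 t : ℂ)) (s - 1) = Complex.Gamma s * riemannZeta s := by
  have hF : mellin (fun t => (hasseTail 0 t : ℂ)) (s - 1) =
      mellin (fun t : ℝ => ((Real.exp (-t) / (1 - Real.exp (-t)) : ℝ) : ℂ)) s := by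
    have h := mellin_cpow_smul (fun t : ℝ => ((Real.exp (-t) / (1 - Real.exp (-t)) : ℝ) : ℂ))
      (s - 1) 1
    rw [sub_add_cancel] at h
    rw [← h]
    congr 1
    ext t
    simp only [hasseTail, range_zero, sum_empty, sub_zero, Complex.cpow_one, smul_eq_mul]
    push_cast
    ring
  have h := hasSum_mellin (ι := ℕ) (a := fun _ => 1) (p := fun k => (k : ℝ) + 1)
    (F := fun t : ℝ => ((Real.exp (-t) / (1 - Real.exp (-t)) : ℝ) : ℂ)) (s := s)
    (fun k => .inr (by positivity)) (by linarith) ?_ ?_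
  · rw [hF, ← h.tsum_eq, zeta_eq_tsum_one_div_nat_add_one_cpow hs, ← tsum_mul_left]
    refine tsum_congr fun k => ?_
    push_cast
    ring
  · intro t (ht : 0 < t)
    have hg := (hasSum_geometric_of_lt_one (Real.exp_pos (-t)).le
      (by simpa using ht)).mul_left (Real.exp (-t))
    rw [← div_eq_mul_inv] at hg
    have hg' := Complex.hasSum_ofReal.mpr hg
    refine hg'.congr_fun fun k => ?_
    rw [one_mul, ← Real.exp_nat_mul, ← Real.exp_add]
    ring_nf
  · simpa using (summable_nat_add_iff 1).mpr (Real.summable_nat_rpow_inv.mpr hs)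

/-- The partial sums of Hasse's series. -/
noncomputable def hassePartialSum (N : ℕ) (s : ℂ) : ℂ :=
  ∑ n ∈ range N, (1 / ((n : ℂ) + 1)) *
    ∑ k ∈ range (n + 1), (-1) ^ k * (n.choose k : ℂ) * ((k : ℂ) + 1) ^ (1 - s)

lemma hassePartialSum_succ (N : ℕ) (s : ℂ) :
    hassePartialSum (N + 1) s = hassePartialSum N s + (1 / ((N : ℂ) + 1)) *
      ∑ k ∈ range (N + 1), (-1) ^ k * (N.choose k : ℂ) * ((k : ℂ) + 1) ^ (1 - s) :=
  sum_range_succ _ _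

lemma differentiable_hassePartialSum (N : ℕ) : Differentiable ℂ (hassePartialSum N) := by
  unfold hassePartialSum
  refine Differentiable.fun_sum fun n _ => Differentiable.const_mul
    (Differentiable.fun_sum fun k _ => Differentiable.const_mul ?_ _) _
  exact (differentiable_id.const_sub 1).const_cpow (.inl (Nat.cast_add_one_ne_zero k))

lemma mellin_hasseTail_of_one_lt_re (N : ℕ) {s : ℂ} (hs : 1 < s.re) :
    mellin (fun t => (hasseTail N t : ℂ)) (s - 1) =
      Complex.Gamma (s - 1) * ((s - 1) * riemannZeta s - hassePartialSum N s) := by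
  have hs' : 0 < (s - 1).re := by simpa using hs
  induction N with
  | zero =>
    have hG := Complex.Gamma_add_one (s - 1) fun h => by simp [h] at hs'
    rw [sub_add_cancel] at hG
    rw [mellin_hasseTail_zero hs, hG]
    simp only [hassePartialSum, range_zero, sum_empty]
    ring
  | succ N ih =>
    have hg := hasMellin_exp_neg_mul_one_sub_exp_neg_pow N hs'
    have hg' := hasMellin_const_smul hg.1 (1 / ((N : ℂ) + 1))
    have h := hasMellin_sub (mellinConvergent_hasseTail (N := N)
      ((neg_nonpos.mpr N.cast_nonneg).trans_lt hs')) hg'.1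
    rw [hg'.2, hg.2, ih] at h
    have hfun : (fun t => (hasseTail (N + 1) t : ℂ)) = fun t => (hasseTail N t : ℂ) -
        (1 / ((N : ℂ) + 1)) • ((Real.exp (-t) * (1 - Real.exp (-t)) ^ N : ℝ) : ℂ) := by
      ext t
      rw [hasseTail_succ]
      push_cast
      rfl
    rw [hfun, h.2, hassePartialSum_succ, smul_eq_mul, neg_sub]
    ring

lemma exists_differentiable_eq_sub_one_mul_riemannZeta :
    ∃ G : ℂ → ℂ, Differentiable ℂ G ∧ ∀ s ≠ 1, G s = (s - 1) * riemannZeta s := by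
  have hG (s : ℂ) (hs : s ≠ 1) :
      Function.update (fun s ↦ (s - 1) * riemannZeta s) 1 1 s = (s - 1) * riemannZeta s :=
    Function.update_of_ne hs _ _
  have hd (s : ℂ) (hs : s ≠ 1) :
      DifferentiableAt ℂ (Function.update (fun s ↦ (s - 1) * riemannZeta s) 1 1) s := by
    refine ((differentiableAt_id.sub_const 1).mul
      (differentiableAt_riemannZeta hs)).congr_of_eventuallyEq ?_
    filter_upwards [isOpen_compl_singleton.mem_nhds hs] with z hz using hG z hz
  refine ⟨_, fun s => ?_, hG⟩
  rcases ne_or_eq s 1 with hs | rfl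
  · exact hd s hs
  refine (Complex.analyticAt_of_differentiable_on_punctured_nhds_of_continuousAt
    ?_ ?_).differentiableAt
  · filter_upwards [self_mem_nhdsWithin] with t ht using hd t ht
  · simpa only [continuousAt_update_same] using riemannZeta_residue_one

lemma sub_one_mul_riemannZeta_sub_hassePartialSum {N : ℕ} {s : ℂ} (hs : s ≠ 1)
    (hN : 1 - (N : ℝ) < s.re) :
    (s - 1) * riemannZeta s - hassePartialSum N s =
      (Complex.Gamma (s - 1))⁻¹ * mellin (fun t => (hasseTail N t : ℂ)) (s - 1) := by
  obtain ⟨G, hGd, hG⟩ := exists_differentiable_eq_sub_one_mul_riemannZeta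
  let U : Set ℂ := {z | 1 - (N : ℝ) < z.re}
  have hUo : IsOpen U := isOpen_lt continuous_const Complex.continuous_re
  have hUc : IsPreconnected U := (convex_halfSpace_re_gt _).isPreconnected
  have hl : AnalyticOnNhd ℂ (fun z => G z - hassePartialSum N z) U :=
    (hGd.sub (differentiable_hassePartialSum N)).differentiableOn.analyticOnNhd hUo
  have hr : AnalyticOnNhd ℂ (fun z => (Complex.Gamma (z - 1))⁻¹ *
      mellin (fun t => (hasseTail N t : ℂ)) (z - 1)) U := by
    refine DifferentiableOn.analyticOnNhd (fun z hz => ?_) hUo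
    have hz' : -(N : ℝ) < (z - 1).re := by
      have : 1 - (N : ℝ) < z.re := hz
      rw [Complex.sub_re, Complex.one_re]
      linarith
    have hsub : DifferentiableAt ℂ (fun z : ℂ => z - 1) z := by fun_prop
    exact (((Complex.differentiable_one_div_Gamma (z - 1)).comp z hsub).mul
      ((differentiableAt_mellin_hasseTail hz').comp z hsub)).differentiableWithinAt
  have h2 : (2 : ℂ) ∈ U := by
    have : (0 : ℝ) ≤ N := N.cast_nonneg
    simp only [U, Set.mem_ofPred_eq, Complex.re_ofNat]
    linarith
  have heq := hl.eqOn_of_preconnected_of_eventuallyEq hr hUc h2 ?_ hN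
  · simpa only [hG s hs] using heq
  · filter_upwards [(isOpen_lt continuous_const Complex.continuous_re).mem_nhds
      (show (2 : ℂ) ∈ {z : ℂ | 1 < z.re} by simp)] with z (hz : 1 < z.re)
    have hz1 : z ≠ 1 := fun h => by simp [h] at hz
    rw [hG z hz1, mellin_hasseTail_of_one_lt_re N hz,
      inv_mul_cancel_left₀ (Complex.Gamma_ne_zero_of_re_pos (by simpa using hz))]

/-- Hasse's globally convergent representation of the Riemann zeta function:
for every `s ≠ 1`, the series `Σ_{n=0}^∞ (1/(n+1)) Σ_{k=0}^n (−1)^k C(n,k) (k+1)^{1−s}`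
converges (in the sense of partial sums) to `(s−1)·ζ(s)`. -/
theorem hasse_representation_zeta (s : ℂ) (hs : s ≠ 1) :
    Tendsto (fun N : ℕ => ∑ n ∈ Finset.range N, (1 / ((n : ℂ) + 1)) *
        ∑ k ∈ Finset.range (n + 1), (-1) ^ k * (n.choose k : ℂ) * ((k : ℂ) + 1) ^ (1 - s))
      atTop (nhds ((s - 1) * riemannZeta s)) := by
  change Tendsto (fun N => hassePartialSum N s) atTop _
  have h := ((tendsto_mellin_hasseTail (s - 1)).const_mul (Complex.Gamma (s - 1))⁻¹).const_sub
    ((s - 1) * riemannZeta s)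
  rw [mul_zero, sub_zero] at h
  refine h.congr' ?_
  obtain ⟨m, hm⟩ := exists_nat_gt (1 - s.re)
  filter_upwards [eventually_ge_atTop m] with N hN
  have hmN : (m : ℝ) ≤ N := by exact_mod_cast hN
  rw [← sub_one_mul_riemannZeta_sub_hassePartialSum hs (by linarith), sub_sub_cancel]
end

section
/- For every integer m ≥ 1, the Stieltjes constant γ_m satisfies γ_m = Σ_{n=0}^∞ |G_{n+1}| Σ_{k=0}^n (−1)^k C(n,k) (ln(k+1))^m/(k+1), the outer series being convergent. -/
open Filter Finset intervalIntegral

/-- Gregory's coefficients `G_n = ∫₀¹ x(x−1)⋯(x−n+1)/n! dx`. -/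
noncomputable def gregoryG (n : ℕ) : ℝ :=
  ∫ x in (0:ℝ)..1, (∏ i ∈ Finset.range n, (x - (i : ℝ))) / (n.factorial : ℝ)

/-- The integrand of `|gregoryG (n + 1)|`, that is `(-1)^n` times the generalized binomial
coefficient of `u` over `n + 1`. -/
noncomputable def gregoryIntegrand (n : ℕ) (u : ℝ) : ℝ :=
  (-1) ^ n * ((∏ i ∈ Finset.range (n + 1), (u - (i : ℝ))) / ((n + 1).factorial : ℝ))

lemma gregoryIntegrand_zero (u : ℝ) : gregoryIntegrand 0 u = u := by
  simp [gregoryIntegrand]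

lemma gregoryIntegrand_succ (n : ℕ) (u : ℝ) :
    gregoryIntegrand (n + 1) u = gregoryIntegrand n u * ((n + 1 - u) / (n + 2)) := by
  have h : ((n + 1).factorial : ℝ) ≠ 0 := by positivity
  have h' : (n : ℝ) + 2 ≠ 0 := by positivity
  rw [gregoryIntegrand, gregoryIntegrand, Finset.prod_range_succ, Nat.factorial_succ (n + 1)]
  push_cast
  field_simp
  ring

lemma gregoryIntegrand_mem_Icc (n : ℕ) {u : ℝ} (hu : u ∈ Set.Icc (0 : ℝ) 1) :
    gregoryIntegrand n u ∈ Set.Icc (0 : ℝ) 1 := by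
  obtain ⟨h0, h1⟩ := hu
  induction n with
  | zero => rw [gregoryIntegrand_zero]; exact ⟨h0, h1⟩
  | succ n ih =>
    rw [gregoryIntegrand_succ]
    have hn : (0 : ℝ) ≤ n := n.cast_nonneg
    have hf0 : 0 ≤ ((n : ℝ) + 1 - u) / (n + 2) := div_nonneg (by linarith) (by linarith)
    have hf1 : ((n : ℝ) + 1 - u) / (n + 2) ≤ 1 := by
      rw [div_le_one (by linarith)]; linarith
    exact ⟨mul_nonneg ih.1 hf0, mul_le_one₀ ih.2 hf0 hf1⟩

lemma continuous_gregoryIntegrand (n : ℕ) : Continuous (gregoryIntegrand n) := by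
  unfold gregoryIntegrand
  fun_prop

lemma abs_gregoryG_succ (n : ℕ) :
    |gregoryG (n + 1)| = ∫ u in (0 : ℝ)..1, gregoryIntegrand n u := by
  have h : ∫ u in (0 : ℝ)..1, gregoryIntegrand n u = (-1) ^ n * gregoryG (n + 1) := by
    simp only [gregoryIntegrand, gregoryG, intervalIntegral.integral_const_mul]
  have h0 : 0 ≤ ∫ u in (0 : ℝ)..1, gregoryIntegrand n u :=
    intervalIntegral.integral_nonneg zero_le_one fun u hu => (gregoryIntegrand_mem_Icc n hu).1
  rw [← abs_of_nonneg h0, h, abs_mul, abs_pow, abs_neg, abs_one, one_pow, one_mul]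

lemma descPochhammer_smeval_eq_prod_range (n : ℕ) (u : ℝ) :
    (descPochhammer ℤ n).smeval u = ∏ i ∈ Finset.range n, (u - (i : ℝ)) := by
  induction n with
  | zero => simp
  | succ n ih =>
    simp [descPochhammer_succ_right, Polynomial.smeval_mul, Polynomial.smeval_natCast, ih,
      Finset.prod_range_succ]

lemma ringChoose_succ_eq_gregoryIntegrand (n : ℕ) (u : ℝ) :
    Ring.choose u (n + 1) = (-1) ^ n * gregoryIntegrand n u := by
  rw [Ring.choose_eq_smul, gregoryIntegrand, ← mul_assoc, ← mul_pow, neg_one_mul, neg_neg, one_pow,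
    one_mul, descPochhammer_smeval_eq_prod_range, smul_eq_mul, div_eq_inv_mul]

lemma hasSum_gregoryIntegrand_mul_pow (u : ℝ) {x : ℝ} (hx0 : 0 < x) (hx1 : x < 1) :
    HasSum (fun n => gregoryIntegrand n u * x ^ n) ((1 - (1 - x) ^ u) / x) := by
  have hmem : -x ∈ Metric.eball (0 : ℝ) 1 := by
    rw [← ENNReal.ofReal_one, Metric.eball_ofReal]
    simp [abs_of_pos hx0, hx1]
  have h := (Real.one_add_rpow_hasFPowerSeriesOnBall_zero (a := u)).hasSum hmem
  simp only [binomialSeries_apply, List.ofFn_const, List.prod_replicate, smul_eq_mul, zero_add] at h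
  rw [← hasSum_nat_add_iff' 1] at h
  simp only [Finset.range_one, Finset.sum_singleton, Ring.choose_zero_right, pow_zero, mul_one] at h
  convert! h.div_const (-x) using 1
  · ext n
    have h1 : ((-1 : ℝ) ^ n) ^ 2 = 1 := by rw [← pow_mul, mul_comm, pow_mul]; simp
    rw [ringChoose_succ_eq_gregoryIntegrand, pow_succ, neg_pow x n,
      eq_div_iff (neg_ne_zero.mpr hx0.ne')]
    linear_combination gregoryIntegrand n u * x ^ n * x * h1
  · rw [div_neg, ← neg_div, ← sub_eq_add_neg, neg_sub]

lemma hasSum_abs_gregoryG_mul_pow {x : ℝ} (hx0 : 0 < x) (hx1 : x < 1) :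
    HasSum (fun n => |gregoryG (n + 1)| * x ^ n) (1 / x + 1 / Real.log (1 - x)) := by
  have hL : Real.log (1 - x) < 0 := Real.log_neg (by linarith) (by linarith)
  have key : HasSum (fun n => ∫ u in (0 : ℝ)..1, gregoryIntegrand n u * x ^ n)
      (∫ u in (0 : ℝ)..1, (1 - (1 - x) ^ u) / x) := by
    refine intervalIntegral.hasSum_integral_of_dominated_convergence (fun n _ => x ^ n)
      (fun n => ((continuous_gregoryIntegrand n).mul continuous_const).aestronglyMeasurable)
      (fun n => .of_forall fun u hu => ?_)
      (.of_forall fun _ _ => summable_geometric_of_lt_one hx0.le hx1)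
      (by simp) (.of_forall fun u _ => hasSum_gregoryIntegrand_mul_pow u hx0 hx1)
    rw [Set.uIoc_of_le zero_le_one] at hu
    obtain ⟨h0, h1⟩ := gregoryIntegrand_mem_Icc n (Set.Ioc_subset_Icc_self hu)
    rw [norm_mul, Real.norm_of_nonneg h0, Real.norm_of_nonneg (by positivity)]
    exact mul_le_of_le_one_left (by positivity) h1
  have hint : ∫ u in (0 : ℝ)..1, (1 - (1 - x) ^ u) / x = 1 / x + 1 / Real.log (1 - x) := by
    have hd (u : ℝ) : HasDerivAt (fun u => (u - (1 - x) ^ u / Real.log (1 - x)) / x)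
        ((1 - (1 - x) ^ u) / x) u := by
      have := (Real.hasStrictDerivAt_const_rpow (a := 1 - x) (by linarith) u).hasDerivAt
      convert! ((hasDerivAt_id u).sub (this.div_const (Real.log (1 - x)))).div_const x using 1
      rw [mul_div_cancel_right₀ _ hL.ne]
    rw [intervalIntegral.integral_eq_sub_of_hasDerivAt (fun u _ => hd u)]
    · simp only [Real.rpow_one, Real.rpow_zero]
      field_simp
      ring
    · refine Continuous.intervalIntegrable ?_ _ _
      exact (continuous_const.sub (Real.continuous_const_rpow (by linarith))).div_const x
  simpa only [abs_gregoryG_succ, intervalIntegral.integral_mul_const, hint] using key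

lemma hasSum_abs_gregoryG_mul_one_sub_exp_pow {t : ℝ} (ht : 0 < t) :
    HasSum (fun n => |gregoryG (n + 1)| * (1 - Real.exp (-t)) ^ n)
      (1 / (1 - Real.exp (-t)) - 1 / t) := by
  have h1 : Real.exp (-t) < 1 := Real.exp_lt_one_iff.mpr (by linarith)
  have h := hasSum_abs_gregoryG_mul_pow (x := 1 - Real.exp (-t)) (by linarith)
    (by linarith [Real.exp_pos (-t)])
  rwa [sub_sub_cancel, Real.log_exp, div_neg, ← sub_eq_add_neg] at h

lemma one_div_one_sub_exp_neg_sub_one_div_le_one {t : ℝ} (ht : 0 < t) :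
    1 / (1 - Real.exp (-t)) - 1 / t ≤ 1 := by
  have h1 : Real.exp (-t) < 1 := Real.exp_lt_one_iff.mpr (by linarith)
  have h2 : Real.exp (-t) * (t + 1) ≤ 1 := by
    calc _ ≤ Real.exp (-t) * Real.exp t := by gcongr; exact Real.add_one_le_exp t
      _ = 1 := by rw [← Real.exp_add]; simp
  rw [div_sub_div _ _ (by linarith) ht.ne', div_le_one (mul_pos (by linarith) ht)]
  nlinarith

/-- The `n`-th alternating binomial sum of `k ↦ (-log (k + 1)) ^ j / (k + 1) ^ s`. -/
noncomputable def binomialLogSum (j n : ℕ) (s : ℂ) : ℂ :=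
  ∑ k ∈ Finset.range (n + 1), (-1) ^ k * (n.choose k : ℂ) *
    (-(Real.log ((k : ℝ) + 1) : ℂ)) ^ j / ((k : ℂ) + 1) ^ s

lemma hasDerivAt_binomialLogSum (j n : ℕ) (s : ℂ) :
    HasDerivAt (binomialLogSum j n) (binomialLogSum (j + 1) n s) s := by
  unfold binomialLogSum
  refine HasDerivAt.fun_sum fun k _ => ?_
  have hk : (k : ℂ) + 1 ≠ 0 := Nat.cast_add_one_ne_zero k
  have hlog : Complex.log ((k : ℂ) + 1) = (Real.log ((k : ℝ) + 1) : ℂ) := by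
    rw [Complex.ofReal_log (by positivity)]
    push_cast
    rfl
  have h := ((hasDerivAt_neg s).const_cpow (c := (k : ℂ) + 1) (.inl hk)).const_mul
    ((-1) ^ k * (n.choose k : ℂ) * (-(Real.log ((k : ℝ) + 1) : ℂ)) ^ j)
  rw [hlog] at h
  simp only [Complex.cpow_neg, ← div_eq_mul_inv] at h
  convert! h using 1
  rw [pow_succ]
  ring

lemma Gamma_mul_binomialLogSum_zero (n : ℕ) {s : ℂ} (hs : 0 < s.re) :
    Complex.Gamma s * binomialLogSum 0 n s =
      mellin (fun t => ((Real.exp (-t) * (1 - Real.exp (-t)) ^ n : ℝ) : ℂ)) s := by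
  have hzero (k : ℕ) (hk : k ∉ Finset.range (n + 1)) : (-1 : ℂ) ^ k * (n.choose k : ℂ) = 0 := by
    rw [Nat.choose_eq_zero_of_lt (by simpa using hk)]
    simp
  have h := hasSum_mellin (a := fun k : ℕ => (-1 : ℂ) ^ k * (n.choose k : ℂ))
    (p := fun k : ℕ => (k : ℝ) + 1) (s := s)
    (F := fun t => ((Real.exp (-t) * (1 - Real.exp (-t)) ^ n : ℝ) : ℂ))
    (fun k => .inr (by positivity)) hs (fun t _ => ?_) ?_
  · refine Eq.trans ?_ ((hasSum_sum_of_ne_finset_zero (s := Finset.range (n + 1))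
      fun k hk => ?_).unique h)
    · simp [binomialLogSum, Finset.mul_sum, mul_div_assoc]
    · rw [hzero k hk]; simp
  · have hF : HasSum (fun k : ℕ => (-1 : ℂ) ^ k * (n.choose k : ℂ) *
        (Real.exp (-((k : ℝ) + 1) * t) : ℂ)) _ :=
      hasSum_sum_of_ne_finset_zero (s := Finset.range (n + 1)) fun k hk => by
        rw [hzero k hk, zero_mul]
    convert! hF using 1
    rw [sub_eq_neg_add, add_pow]
    push_cast
    rw [Finset.mul_sum]
    refine Finset.sum_congr rfl fun k _ => ?_
    rw [neg_pow, one_pow, ← Complex.exp_nat_mul,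
      show -((k : ℂ) + 1) * t = -t + k * -t by ring, Complex.exp_add]
    ring
  · exact summable_of_ne_finset_zero (s := Finset.range (n + 1)) fun k hk => by
      rw [hzero k hk]; simp

/-- An integrable bound for `t ^ (s - 1) * exp (-t)`, uniform over `‖s - 1‖ ≤ 1 / 2`. -/
noncomputable def gammaMajorant (t : ℝ) : ℝ :=
  Real.exp (-t) * t ^ ((1 / 2 : ℝ) - 1) + Real.exp (-t) * t ^ ((3 / 2 : ℝ) - 1)

lemma gammaMajorant_nonneg {t : ℝ} (ht : 0 < t) : 0 ≤ gammaMajorant t := by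
  unfold gammaMajorant
  positivity

lemma integrableOn_gammaMajorant :
    MeasureTheory.IntegrableOn gammaMajorant (Set.Ioi 0) :=
  (Real.GammaIntegral_convergent (by norm_num)).add (Real.GammaIntegral_convergent (by norm_num))

lemma norm_cpow_mul_exp_neg_le {s : ℂ} (hs : s ∈ Metric.closedBall (1 : ℂ) (1 / 2)) {t : ℝ}
    (ht : 0 < t) : ‖(t : ℂ) ^ (s - 1)‖ * Real.exp (-t) ≤ gammaMajorant t := by
  have hre : |s.re - 1| ≤ 1 / 2 := by
    have := (Complex.abs_re_le_norm (s - 1)).trans (mem_closedBall_iff_norm.mp hs)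
    simpa using this
  obtain ⟨h1, h2⟩ := abs_le.mp hre
  rw [Complex.norm_cpow_eq_rpow_re_of_pos ht, gammaMajorant, ← mul_add, mul_comm]
  gcongr
  have p1 : 0 ≤ t ^ ((1 / 2 : ℝ) - 1) := by positivity
  have p2 : 0 ≤ t ^ ((3 / 2 : ℝ) - 1) := by positivity
  rcases le_total t 1 with h | h
  · have := Real.rpow_le_rpow_of_exponent_ge ht h
      (show (1 / 2 : ℝ) - 1 ≤ (s - 1).re by simp only [Complex.sub_re, Complex.one_re]; linarith)
    linarith
  · have := Real.rpow_le_rpow_of_exponent_le h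
      (show (s - 1).re ≤ (3 / 2 : ℝ) - 1 by simp only [Complex.sub_re, Complex.one_re]; linarith)
    linarith

lemma one_sub_exp_neg_nonneg {t : ℝ} (ht : 0 < t) : 0 ≤ 1 - Real.exp (-t) :=
  sub_nonneg.mpr (Real.exp_le_one_iff.mpr (by linarith))

lemma sum_abs_gregoryG_mul_pow_le_one {t : ℝ} (ht : 0 < t) (S : Finset ℕ) :
    ∑ n ∈ S, |gregoryG (n + 1)| * (1 - Real.exp (-t)) ^ n ≤ 1 :=
  (sum_le_hasSum S (fun n _ => mul_nonneg (abs_nonneg _) (pow_nonneg (one_sub_exp_neg_nonneg ht) n))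
    (hasSum_abs_gregoryG_mul_one_sub_exp_pow ht)).trans
    (one_div_one_sub_exp_neg_sub_one_div_le_one ht)

lemma integrableOn_gammaMajorant_mul (n : ℕ) :
    MeasureTheory.IntegrableOn
      (fun t => gammaMajorant t * (|gregoryG (n + 1)| * (1 - Real.exp (-t)) ^ n)) (Set.Ioi 0) := by
  refine MeasureTheory.Integrable.mono integrableOn_gammaMajorant
    (integrableOn_gammaMajorant.aestronglyMeasurable.mul (by fun_prop)) ?_
  refine (MeasureTheory.ae_restrict_iff' measurableSet_Ioi).mpr (.of_forall fun t ht => ?_)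
  have h0 := mul_nonneg (abs_nonneg (gregoryG (n + 1))) (pow_nonneg (one_sub_exp_neg_nonneg ht) n)
  rw [norm_mul, Real.norm_of_nonneg h0]
  refine mul_le_of_le_one_right (norm_nonneg _) ?_
  simpa using sum_abs_gregoryG_mul_pow_le_one ht {n}

lemma summable_integral_gammaMajorant_mul :
    Summable fun n => ∫ t in Set.Ioi (0 : ℝ),
      gammaMajorant t * (|gregoryG (n + 1)| * (1 - Real.exp (-t)) ^ n) := by
  refine summable_of_sum_range_le (c := ∫ t in Set.Ioi (0 : ℝ), gammaMajorant t)
    (fun n => MeasureTheory.setIntegral_nonneg measurableSet_Ioi fun t ht =>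
      mul_nonneg (gammaMajorant_nonneg ht)
        (mul_nonneg (abs_nonneg _) (pow_nonneg (one_sub_exp_neg_nonneg ht) n))) fun N => ?_
  rw [← MeasureTheory.integral_finsetSum _ fun n _ => integrableOn_gammaMajorant_mul n]
  refine MeasureTheory.setIntegral_mono_on
    (MeasureTheory.integrable_finsetSum _ fun n _ => integrableOn_gammaMajorant_mul n)
    integrableOn_gammaMajorant measurableSet_Ioi fun t ht => ?_
  rw [← Finset.mul_sum]
  exact mul_le_of_le_one_right (gammaMajorant_nonneg ht) (sum_abs_gregoryG_mul_pow_le_one ht _)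

lemma norm_cpow_smul_le {s : ℂ} (hs : s ∈ Metric.closedBall (1 : ℂ) (1 / 2)) {t y : ℝ}
    (ht : 0 < t) (hy : 0 ≤ y) :
    ‖(t : ℂ) ^ (s - 1) • ((Real.exp (-t) * y : ℝ) : ℂ)‖ ≤ gammaMajorant t * y := by
  rw [norm_smul, Complex.norm_real, Real.norm_of_nonneg (by positivity), ← mul_assoc]
  exact mul_le_mul_of_nonneg_right (norm_cpow_mul_exp_neg_le hs ht) hy

lemma norm_gregory_term_le (n : ℕ) {s : ℂ} (hs : s ∈ Metric.closedBall (1 : ℂ) (1 / 2)) {t : ℝ}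
    (ht : 0 < t) :
    ‖(t : ℂ) ^ (s - 1) •
      ((Real.exp (-t) * (|gregoryG (n + 1)| * (1 - Real.exp (-t)) ^ n) : ℝ) : ℂ)‖ ≤
      gammaMajorant t * (|gregoryG (n + 1)| * (1 - Real.exp (-t)) ^ n) :=
  norm_cpow_smul_le hs ht
    (mul_nonneg (abs_nonneg _) (pow_nonneg (one_sub_exp_neg_nonneg ht) n))

lemma mellinConvergent_gregory_term (n : ℕ) {s : ℂ}
    (hs : s ∈ Metric.closedBall (1 : ℂ) (1 / 2)) :
    MellinConvergent (fun t =>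
      ((Real.exp (-t) * (|gregoryG (n + 1)| * (1 - Real.exp (-t)) ^ n) : ℝ) : ℂ)) s := by
  refine MeasureTheory.Integrable.mono' (integrableOn_gammaMajorant_mul n) ?_
    ((MeasureTheory.ae_restrict_iff' measurableSet_Ioi).mpr
      (.of_forall fun t ht => norm_gregory_term_le n hs ht))
  exact Measurable.aestronglyMeasurable (by fun_prop)

lemma re_pos_of_mem_closedBall {s : ℂ} (hs : s ∈ Metric.closedBall (1 : ℂ) (1 / 2)) :
    0 < s.re := by
  have := (Complex.abs_re_le_norm (s - 1)).trans (mem_closedBall_iff_norm.mp hs)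
  have := (abs_le.mp this).1
  simp only [Complex.sub_re, Complex.one_re] at this
  linarith

lemma Gamma_mul_abs_gregoryG_mul_binomialLogSum (n : ℕ) {s : ℂ} (hs : 0 < s.re) :
    Complex.Gamma s * ((|gregoryG (n + 1)| : ℝ) * binomialLogSum 0 n s) =
      mellin (fun t =>
        ((Real.exp (-t) * (|gregoryG (n + 1)| * (1 - Real.exp (-t)) ^ n) : ℝ) : ℂ)) s := by
  rw [mul_left_comm, Gamma_mul_binomialLogSum_zero n hs, ← smul_eq_mul, ← mellin_const_smul]
  congr 1
  ext t
  rw [smul_eq_mul, ← Complex.ofReal_mul, mul_left_comm]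

lemma norm_abs_gregoryG_mul_binomialLogSum_le (n : ℕ) {s : ℂ}
    (hs : s ∈ Metric.closedBall (1 : ℂ) (1 / 2)) :
    ‖((|gregoryG (n + 1)| : ℝ) : ℂ) * binomialLogSum 0 n s‖ ≤ ‖(Complex.Gamma s)⁻¹‖ *
      ∫ t in Set.Ioi (0 : ℝ),
        gammaMajorant t * (|gregoryG (n + 1)| * (1 - Real.exp (-t)) ^ n) := by
  have hs0 := re_pos_of_mem_closedBall hs
  rw [← inv_mul_cancel_left₀ (Complex.Gamma_ne_zero_of_re_pos hs0)
    (((|gregoryG (n + 1)| : ℝ) : ℂ) * binomialLogSum 0 n s),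
    Gamma_mul_abs_gregoryG_mul_binomialLogSum n hs0, norm_mul]
  gcongr
  exact MeasureTheory.norm_integral_le_of_norm_le (integrableOn_gammaMajorant_mul n)
    ((MeasureTheory.ae_restrict_iff' measurableSet_Ioi).mpr
      (.of_forall fun t ht => norm_gregory_term_le n hs ht))

lemma mellin_exp_neg_mul_sub {s : ℂ} (hs : s ∈ Metric.closedBall (1 : ℂ) (1 / 2))
    (hs1 : 1 < s.re) :
    mellin (fun t => ((Real.exp (-t) * (1 / (1 - Real.exp (-t)) - 1 / t) : ℝ) : ℂ)) s =
      Complex.Gamma s * (riemannZeta s - 1 / (s - 1)) := by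
  have hs0 : 0 < s.re := by linarith
  have hsub : s - 1 ≠ 0 := fun h => by simp [sub_eq_zero.mp h] at hs1
  have hzeta : mellin (fun t => ((Real.exp (-t) * (1 / (1 - Real.exp (-t))) : ℝ) : ℂ)) s =
      Complex.Gamma s * riemannZeta s := by
    have h := hasSum_mellin (a := fun _ : ℕ => (1 : ℂ)) (p := fun k : ℕ => (k : ℝ) + 1) (s := s)
      (F := fun t => ((Real.exp (-t) * (1 / (1 - Real.exp (-t))) : ℝ) : ℂ))
      (fun k => .inr (by positivity)) hs0 (fun t ht => ?_) ?_
    · rw [zeta_eq_tsum_one_div_nat_add_one_cpow hs1, ← tsum_mul_left, ← h.tsum_eq]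
      simp [div_eq_mul_inv]
    · have hg := (hasSum_geometric_of_lt_one (Real.exp_nonneg (-t))
        (Real.exp_lt_one_iff.mpr (neg_lt_zero.mpr ht))).mul_left (Real.exp (-t))
      rw [← one_div] at hg
      convert! Complex.hasSum_ofReal.mpr hg using 1
      ext k
      rw [one_mul, ← Real.exp_nat_mul, ← Real.exp_add]
      congr 2
      ring
    · have := (summable_nat_add_iff 1).mpr (Real.summable_one_div_nat_rpow.mpr hs1)
      simpa using this
  have hGamma (t : ℝ) (ht : t ∈ Set.Ioi 0) :
      (t : ℂ) ^ (s - 1) • ((Real.exp (-t) * (1 / t) : ℝ) : ℂ) =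
      (Real.exp (-t) : ℂ) * (t : ℂ) ^ (s - 1 - 1) := by
    have ht' : (t : ℂ) ≠ 0 := Complex.ofReal_ne_zero.mpr (ne_of_gt ht)
    rw [Complex.cpow_sub (s - 1) 1 ht', Complex.cpow_one, smul_eq_mul]
    push_cast
    ring
  have hre : 0 < (s - 1).re := by simpa using hs1
  have hpole : HasMellin (fun t => ((Real.exp (-t) * (1 / t) : ℝ) : ℂ)) s
      (Complex.Gamma s * (1 / (s - 1))) := by
    constructor
    · exact (Complex.GammaIntegral_convergent hre).congr_fun (fun t ht => (hGamma t ht).symm)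
        measurableSet_Ioi
    · have hrec := Complex.Gamma_add_one (s - 1) hsub
      rw [sub_add_cancel] at hrec
      rw [mellin, MeasureTheory.setIntegral_congr_fun measurableSet_Ioi hGamma, hrec,
        mul_one_div, mul_div_cancel_left₀ _ hsub, Complex.Gamma_eq_integral hre,
        Complex.GammaIntegral]
  have hconv : MellinConvergent
      (fun t => ((Real.exp (-t) * (1 / (1 - Real.exp (-t)) - 1 / t) : ℝ) : ℂ)) s := by
    refine MeasureTheory.Integrable.mono' integrableOn_gammaMajorant
      (Measurable.aestronglyMeasurable (by fun_prop))
      ((MeasureTheory.ae_restrict_iff' measurableSet_Ioi).mpr (.of_forall fun t ht => ?_))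
    have h0 : 0 ≤ 1 / (1 - Real.exp (-t)) - 1 / t :=
      (hasSum_abs_gregoryG_mul_one_sub_exp_pow ht).nonneg fun n =>
        mul_nonneg (abs_nonneg _) (pow_nonneg (one_sub_exp_neg_nonneg ht) n)
    exact (norm_cpow_smul_le hs ht h0).trans (mul_le_of_le_one_right (gammaMajorant_nonneg ht)
      (one_div_one_sub_exp_neg_sub_one_div_le_one ht))
  have hadd := (hasMellin_add hconv hpole.1).2
  rw [hpole.2] at hadd
  rw [mul_sub, ← hzeta, eq_sub_iff_add_eq, ← hadd]
  congr 1
  ext t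
  rw [← Complex.ofReal_add, ← mul_add, sub_add_cancel]

lemma hasSum_abs_gregoryG_mul_binomialLogSum {s : ℂ}
    (hs : s ∈ Metric.closedBall (1 : ℂ) (1 / 2)) (hs1 : 1 < s.re) :
    HasSum (fun n => ((|gregoryG (n + 1)| : ℝ) : ℂ) * binomialLogSum 0 n s)
      (riemannZeta s - 1 / (s - 1)) := by
  have hs0 := re_pos_of_mem_closedBall hs
  rw [← hasSum_mul_left_iff (Complex.Gamma_ne_zero_of_re_pos hs0), ← mellin_exp_neg_mul_sub hs hs1]
  simp only [Gamma_mul_abs_gregoryG_mul_binomialLogSum _ hs0]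
  have h := MeasureTheory.hasSum_integral_of_summable_integral_norm
    (fun n => mellinConvergent_gregory_term n hs) (.of_nonneg_of_le
      (fun n => MeasureTheory.integral_nonneg fun t => norm_nonneg _)
      (fun n => MeasureTheory.setIntegral_mono_on (mellinConvergent_gregory_term n hs).norm
        (integrableOn_gammaMajorant_mul n) measurableSet_Ioi
        fun t ht => norm_gregory_term_le n hs ht)
      summable_integral_gammaMajorant_mul)
  convert! h using 1
  refine MeasureTheory.setIntegral_congr_fun measurableSet_Ioi fun t ht => ?_
  have := ((Complex.hasSum_ofReal.mpr ((hasSum_abs_gregoryG_mul_one_sub_exp_pow ht).mul_left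
    (Real.exp (-t)))).mul_left ((t : ℂ) ^ (s - 1)))
  exact this.tsum_eq.symm

lemma tendstoUniformlyOn_sum_binomialLogSum_zero :
    TendstoUniformlyOn
      (fun N s => ∑ n ∈ Finset.range N, ((|gregoryG (n + 1)| : ℝ) : ℂ) * binomialLogSum 0 n s)
      (fun s => ∑' n, ((|gregoryG (n + 1)| : ℝ) : ℂ) * binomialLogSum 0 n s) atTop
      (Metric.ball (1 : ℂ) (1 / 2)) := by
  obtain ⟨C, hC⟩ := (isCompact_closedBall (1 : ℂ) (1 / 2)).exists_bound_of_continuousOn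
    Complex.differentiable_one_div_Gamma.continuous.continuousOn
  refine tendstoUniformlyOn_tsum_nat (summable_integral_gammaMajorant_mul.mul_left C)
    fun n s hs => ?_
  have hs' := Metric.ball_subset_closedBall hs
  refine (norm_abs_gregoryG_mul_binomialLogSum_le n hs').trans ?_
  exact mul_le_mul_of_nonneg_right (hC s hs') (MeasureTheory.setIntegral_nonneg measurableSet_Ioi
    fun t ht => mul_nonneg (gammaMajorant_nonneg ht)
      (mul_nonneg (abs_nonneg _) (pow_nonneg (one_sub_exp_neg_nonneg ht) n)))

lemma hasDerivAt_sum_binomialLogSum (j N : ℕ) (s : ℂ) :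
    HasDerivAt
      (fun s => ∑ n ∈ Finset.range N, ((|gregoryG (n + 1)| : ℝ) : ℂ) * binomialLogSum j n s)
      (∑ n ∈ Finset.range N, ((|gregoryG (n + 1)| : ℝ) : ℂ) * binomialLogSum (j + 1) n s) s :=
  HasDerivAt.fun_sum fun n _ => (hasDerivAt_binomialLogSum j n s).const_mul _

lemma tsum_binomialLogSum_eqOn {g : ℂ → ℂ} (hg : Differentiable ℂ g)
    (hgz : ∀ s : ℂ, s ≠ 1 → g s = riemannZeta s - 1 / (s - 1)) :
    Set.EqOn (fun s => ∑' n, ((|gregoryG (n + 1)| : ℝ) : ℂ) * binomialLogSum 0 n s) g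
      (Metric.ball (1 : ℂ) (1 / 2)) := by
  have hdiff := tendstoUniformlyOn_sum_binomialLogSum_zero.tendstoLocallyUniformlyOn.differentiableOn
    (.of_forall fun N s _ => (hasDerivAt_sum_binomialLogSum 0 N s).differentiableAt
      |>.differentiableWithinAt) Metric.isOpen_ball
  have hmem : (5 / 4 : ℂ) ∈ Metric.ball (1 : ℂ) (1 / 2) := by
    rw [mem_ball_iff_norm]; norm_num
  refine (hdiff.analyticOnNhd Metric.isOpen_ball).eqOn_of_preconnected_of_eventuallyEq
    (hg.differentiableOn.analyticOnNhd Metric.isOpen_ball)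
    (convex_ball _ _).isPreconnected hmem ?_
  have hre : ∀ᶠ s : ℂ in nhds (5 / 4), 1 < s.re :=
    continuousAt_const.eventually_lt Complex.continuous_re.continuousAt (by norm_num)
  filter_upwards [hre, Metric.isOpen_ball.mem_nhds hmem] with s hs1 hs
  rw [hgz s (by rintro rfl; simp at hs1)]
  exact (hasSum_abs_gregoryG_mul_binomialLogSum (Metric.ball_subset_closedBall hs) hs1).tsum_eq

lemma tendstoLocallyUniformlyOn_iteratedDeriv (m : ℕ) {g : ℂ → ℂ} (hg : Differentiable ℂ g)
    (hgz : ∀ s : ℂ, s ≠ 1 → g s = riemannZeta s - 1 / (s - 1)) :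
    TendstoLocallyUniformlyOn
      (fun N s => ∑ n ∈ Finset.range N, ((|gregoryG (n + 1)| : ℝ) : ℂ) * binomialLogSum m n s)
      (iteratedDeriv m g) atTop (Metric.ball (1 : ℂ) (1 / 2)) := by
  induction m with
  | zero =>
    rw [iteratedDeriv_zero]
    exact tendstoUniformlyOn_sum_binomialLogSum_zero.tendstoLocallyUniformlyOn.congr_right
      (tsum_binomialLogSum_eqOn hg hgz)
  | succ m ih =>
    rw [iteratedDeriv_succ]
    convert! ih.deriv (.of_forall fun N s _ => (hasDerivAt_sum_binomialLogSum m N s).differentiableAt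
      |>.differentiableWithinAt) Metric.isOpen_ball using 1
    ext N s
    exact (hasDerivAt_sum_binomialLogSum m N s).deriv.symm

/-- Series for the Stieltjes constants with Gregory's coefficients:
if `g` is the entire function agreeing with `ζ(s) − 1/(s−1)` away from `1`, then for `m ≥ 1`
the `m`-th Stieltjes constant `γ_m = (−1)^m g^{(m)}(1)` satisfies
`γ_m = Σ_{n=0}^∞ |G_{n+1}| Σ_{k=0}^n (−1)^k C(n,k) (ln(k+1))^m/(k+1)`,
the outer series being convergent. -/
theorem stieltjes_gregory_series (m : ℕ) (hm : 1 ≤ m) (g : ℂ → ℂ) (hg : Differentiable ℂ g)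
    (hgz : ∀ s : ℂ, s ≠ 1 → g s = riemannZeta s - 1 / (s - 1)) :
    ∃ L : ℂ,
      Tendsto (fun N : ℕ => ∑ n ∈ Finset.range N, (Complex.ofReal |gregoryG (n + 1)|) *
          ∑ k ∈ Finset.range (n + 1), (-1) ^ k * (n.choose k : ℂ) *
            (Complex.ofReal (Real.log ((k : ℝ) + 1))) ^ m / ((k : ℂ) + 1))
        atTop (nhds L) ∧
      (-1) ^ m * iteratedDeriv m g 1 = L := by
  have h := (tendstoLocallyUniformlyOn_iteratedDeriv m hg hgz).tendsto_at
    (Metric.mem_ball_self (show (0 : ℝ) < 1 / 2 by norm_num))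
  refine ⟨_, (h.const_mul ((-1 : ℂ) ^ m)).congr fun N => ?_, rfl⟩
  rw [Finset.mul_sum]
  refine Finset.sum_congr rfl fun n _ => ?_
  rw [binomialLogSum, mul_left_comm, Finset.mul_sum]
  congr 1
  refine Finset.sum_congr rfl fun k _ => ?_
  have h1 : ((-1 : ℂ) ^ m) ^ 2 = 1 := by rw [← pow_mul, mul_comm, pow_mul]; simp
  rw [neg_pow (Complex.ofReal _), Complex.cpow_one]
  linear_combination ((-1) ^ k * (n.choose k : ℂ) *
    (Real.log ((k : ℝ) + 1) : ℂ) ^ m / ((k : ℂ) + 1)) * h1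
end

section
/- For every integer m ≥ 1, the normalized Maclaurin coefficient δ_m of the regularized zeta function satisfies δ_m = Σ_{n=0}^∞ |G_{n+1}| Σ_{k=0}^n (−1)^k C(n,k) (ln(k+1))^m, the outer series being convergent. -/
open Filter Finset intervalIntegral

theorem neg_one_pow_mul_prod_range_succ_sub (n : ℕ) (y : ℝ) :
    (-1) ^ n * ∏ i ∈ Finset.range (n + 1), (y - (i : ℝ)) =
      y * ∏ i ∈ Finset.range n, ((i : ℝ) + 1 - y) := by
  induction n with
  | zero => simp
  | succ n ih =>
    rw [Finset.prod_range_succ, Finset.prod_range_succ (fun i : ℕ => (i : ℝ) + 1 - y),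
      ← mul_assoc y, ← ih]
    push_cast
    ring

theorem neg_one_pow_mul_prod_div_factorial_nonneg (n : ℕ) {y : ℝ} (hy : y ∈ Set.Icc (0 : ℝ) 1) :
    0 ≤ (-1) ^ n * ((∏ i ∈ Finset.range (n + 1), (y - (i : ℝ))) / ((n + 1).factorial : ℝ)) := by
  rw [← mul_div_assoc, neg_one_pow_mul_prod_range_succ_sub]
  refine div_nonneg (mul_nonneg hy.1 (Finset.prod_nonneg fun i _ => ?_)) (Nat.cast_nonneg _)
  linarith [hy.2, (Nat.cast_nonneg i : (0 : ℝ) ≤ i)]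

theorem neg_one_pow_mul_prod_div_factorial_le (n : ℕ) {y : ℝ} (hy : y ∈ Set.Icc (0 : ℝ) 1) :
    (-1) ^ n * ((∏ i ∈ Finset.range (n + 1), (y - (i : ℝ))) / ((n + 1).factorial : ℝ)) ≤
      1 / ((n : ℝ) + 1) := by
  rw [← mul_div_assoc, neg_one_pow_mul_prod_range_succ_sub]
  have hprod : ∏ i ∈ Finset.range n, ((i : ℝ) + 1 - y) ≤ (n.factorial : ℝ) := by
    rw [← Finset.prod_range_add_one_eq_factorial]
    push_cast
    refine Finset.prod_le_prod (fun i _ => ?_) (fun i _ => by linarith [hy.1])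
    linarith [hy.2, (Nat.cast_nonneg i : (0 : ℝ) ≤ i)]
  have hnonneg : 0 ≤ ∏ i ∈ Finset.range n, ((i : ℝ) + 1 - y) :=
    Finset.prod_nonneg fun i _ => by linarith [hy.2, (Nat.cast_nonneg i : (0 : ℝ) ≤ i)]
  have hfac : (0 : ℝ) < n.factorial := by positivity
  rw [Nat.factorial_succ, div_le_div_iff₀ (by positivity) (by positivity)]
  push_cast
  have : y * ∏ i ∈ Finset.range n, ((i : ℝ) + 1 - y) ≤ n.factorial := by
    nlinarith [hy.1, hy.2]
  nlinarith [(Nat.cast_nonneg n : (0 : ℝ) ≤ n)]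

theorem abs_gregoryG_succ_s5 (n : ℕ) :
    |gregoryG (n + 1)| = ∫ y in (0 : ℝ)..1,
      (-1) ^ n * ((∏ i ∈ Finset.range (n + 1), (y - (i : ℝ))) / ((n + 1).factorial : ℝ)) := by
  have h0 := intervalIntegral.integral_nonneg (μ := MeasureTheory.volume) zero_le_one
    fun y hy => neg_one_pow_mul_prod_div_factorial_nonneg n hy
  rw [← abs_of_nonneg h0, intervalIntegral.integral_const_mul, abs_mul, abs_pow, abs_neg, abs_one,
    one_pow, one_mul]
  rfl

theorem abs_gregoryG_succ_le (n : ℕ) : |gregoryG (n + 1)| ≤ 1 / ((n : ℝ) + 1) := by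
  rw [abs_gregoryG_succ_s5]
  have hcont : Continuous fun y : ℝ =>
      (-1) ^ n * ((∏ i ∈ Finset.range (n + 1), (y - (i : ℝ))) / ((n + 1).factorial : ℝ)) := by
    fun_prop
  calc _ ≤ ∫ y in (0 : ℝ)..1, 1 / ((n : ℝ) + 1) :=
        intervalIntegral.integral_mono_on zero_le_one (hcont.intervalIntegrable _ _)
          intervalIntegrable_const fun y hy => neg_one_pow_mul_prod_div_factorial_le n hy
    _ = _ := by simp

theorem ringChoose_eq_prod_div_factorial (y : ℝ) (n : ℕ) :
    Ring.choose y n = (∏ i ∈ Finset.range n, (y - (i : ℝ))) / (n.factorial : ℝ) := by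
  rw [Ring.choose_eq_smul, smul_eq_mul, div_eq_inv_mul]
  congr 1
  induction n with
  | zero => simp
  | succ n ih =>
    rw [descPochhammer_succ_right, Polynomial.smeval_mul, ih, Finset.prod_range_succ]
    simp [Polynomial.smeval_natCast]

theorem hasSum_neg_one_pow_mul_prod_div_factorial_mul_pow (y : ℝ) {x : ℝ}
    (hx : x ∈ Set.Ioo (0 : ℝ) 1) :
    HasSum (fun n : ℕ => (-1) ^ n *
      ((∏ i ∈ Finset.range (n + 1), (y - (i : ℝ))) / ((n + 1).factorial : ℝ)) * x ^ n)
      ((1 - (1 - x) ^ y) / x) := by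
  have hmem : -x ∈ Metric.eball (0 : ℝ) 1 := by
    rw [← ENNReal.ofReal_one, Metric.eball_ofReal]
    simpa [abs_of_pos hx.1] using hx.2
  have h := (Real.one_add_rpow_hasFPowerSeriesOnBall_zero (a := y)).hasSum hmem
  simp only [binomialSeries_apply, List.ofFn_const, List.prod_replicate, smul_eq_mul, zero_add,
    ringChoose_eq_prod_div_factorial] at h
  rw [← hasSum_nat_add_iff' 1] at h
  have h2 := h.mul_left (-1 / x)
  convert! h2 using 1
  · ext n
    have := hx.1.ne'
    rw [neg_pow x]
    field_simp
    ring
  · have := hx.1.ne'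
    simp
    field_simp
    ring_nf

theorem hasSum_abs_gregoryG_succ_mul_pow {x : ℝ} (hx : x ∈ Set.Ioo (0 : ℝ) 1) :
    HasSum (fun n : ℕ => |gregoryG (n + 1)| * x ^ n) (1 / x + 1 / Real.log (1 - x)) := by
  have hx1 : 0 < 1 - x := by linarith [hx.2]
  have hlog : Real.log (1 - x) ≠ 0 := (Real.log_neg hx1 (by linarith [hx.1])).ne
  have hint : ∫ y in (0 : ℝ)..1, (1 - (1 - x) ^ y) / x = 1 / x + 1 / Real.log (1 - x) := by
    have hderiv : ∀ y ∈ Set.uIcc (0 : ℝ) 1, HasDerivAt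
        (fun y => (y - (1 - x) ^ y / Real.log (1 - x)) / x) ((1 - (1 - x) ^ y) / x) y := by
      intro y _
      have := (Real.hasStrictDerivAt_const_rpow hx1 y).hasDerivAt
      have := ((hasDerivAt_id y).sub (this.div_const (Real.log (1 - x)))).div_const x
      convert! this using 1
      field_simp
    rw [intervalIntegral.integral_eq_sub_of_hasDerivAt hderiv]
    · have := hx.1.ne'
      simp
      field_simp
      ring
    · apply Continuous.intervalIntegrable
      have : Continuous fun y : ℝ => (1 - x) ^ y := Real.continuous_const_rpow hx1.ne'
      fun_prop
  rw [← hint]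
  simp_rw [abs_gregoryG_succ_s5, ← intervalIntegral.integral_mul_const]
  refine intervalIntegral.hasSum_integral_of_dominated_convergence (fun n _ => x ^ n)
    (fun n => ?_) (fun n => ?_) ?_ ?_ ?_
  · apply Continuous.aestronglyMeasurable
    fun_prop
  · refine MeasureTheory.ae_of_all _ fun y hy => ?_
    rw [Set.uIoc_of_le zero_le_one] at hy
    have hy' := Set.Ioc_subset_Icc_self hy
    have h0 := neg_one_pow_mul_prod_div_factorial_nonneg n hy'
    have h1 := neg_one_pow_mul_prod_div_factorial_le n hy'
    have h2 : 1 / ((n : ℝ) + 1) ≤ 1 := by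
      rw [div_le_one (by positivity)]
      linarith [(Nat.cast_nonneg n : (0 : ℝ) ≤ n)]
    have h3 : 0 ≤ x ^ n := pow_nonneg hx.1.le n
    rw [Real.norm_of_nonneg (mul_nonneg h0 h3)]
    exact mul_le_of_le_one_left h3 (h1.trans h2)
  · exact MeasureTheory.ae_of_all _ fun y _ => summable_geometric_of_lt_one hx.1.le hx.2
  · exact intervalIntegrable_const
  · exact MeasureTheory.ae_of_all _ fun y _ =>
      hasSum_neg_one_pow_mul_prod_div_factorial_mul_pow y hx

/-- The alternating binomial sum `Σ_{k ≤ n} (-1)^k C(n,k) (k+1)^{-s}`. -/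
noncomputable def binomialDirichletSum (n : ℕ) (s : ℂ) : ℂ :=
  ∑ k ∈ Finset.range (n + 1), (-1) ^ k * (n.choose k : ℂ) *
    Complex.exp (-(Complex.ofReal (Real.log ((k : ℝ) + 1))) * s)

theorem integral_cpow_mul_exp_neg_succ_mul {a : ℂ} (ha : 0 < a.re) (k : ℕ) :
    ∫ t : ℝ in Set.Ioi 0, (t : ℂ) ^ (a - 1) * Complex.exp (-(((k : ℂ) + 1) * t)) =
      Complex.Gamma a * Complex.exp (-(Complex.ofReal (Real.log ((k : ℝ) + 1))) * a) := by
  have h := Complex.integral_cpow_mul_exp_neg_mul_Ioi ha (r := (k : ℝ) + 1) (by positivity)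
  push_cast at h
  have hk : ((k : ℂ) + 1) ≠ 0 := Nat.cast_add_one_ne_zero k
  have harg : ((k : ℂ) + 1).arg ≠ Real.pi := by
    have := Complex.arg_ofReal_of_nonneg (x := (k : ℝ) + 1) (by positivity)
    push_cast at this
    rw [this]
    exact Real.pi_pos.ne
  rw [h, one_div, Complex.inv_cpow _ _ harg, Complex.cpow_def_of_ne_zero hk, ← Complex.exp_neg,
    Complex.ofReal_log (by positivity)]
  push_cast
  ring_nf

theorem integrableOn_cpow_mul_exp_neg_succ_mul {a : ℂ} (ha : 0 < a.re) (k : ℕ) :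
    MeasureTheory.IntegrableOn
      (fun t : ℝ => (t : ℂ) ^ (a - 1) * Complex.exp (-(((k : ℂ) + 1) * t))) (Set.Ioi 0) := by
  by_contra hcon
  have h := integral_cpow_mul_exp_neg_succ_mul ha k
  rw [MeasureTheory.integral_undef hcon] at h
  exact mul_ne_zero (Complex.Gamma_ne_zero_of_re_pos ha) (Complex.exp_ne_zero _) h.symm

theorem integrableOn_cpow_mul_sum_exp {a : ℂ} (ha : 0 < a.re) (c : ℕ → ℂ) (N : ℕ) :
    MeasureTheory.IntegrableOn (fun t : ℝ => (t : ℂ) ^ (a - 1) *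
      ∑ k ∈ Finset.range N, c k * Complex.exp (-(((k : ℂ) + 1) * t))) (Set.Ioi 0) := by
  simp_rw [Finset.mul_sum, mul_left_comm _ (c _)]
  exact MeasureTheory.integrable_finsetSum _ fun k _ =>
    (integrableOn_cpow_mul_exp_neg_succ_mul ha k).const_mul (c k)

theorem integral_cpow_mul_sum_exp {a : ℂ} (ha : 0 < a.re) (c : ℕ → ℂ) (N : ℕ) :
    ∫ t : ℝ in Set.Ioi 0, (t : ℂ) ^ (a - 1) *
        ∑ k ∈ Finset.range N, c k * Complex.exp (-(((k : ℂ) + 1) * t)) =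
      Complex.Gamma a * ∑ k ∈ Finset.range N,
        c k * Complex.exp (-(Complex.ofReal (Real.log ((k : ℝ) + 1))) * a) := by
  simp_rw [Finset.mul_sum, mul_left_comm _ (c _)]
  rw [MeasureTheory.integral_finsetSum _ fun k _ =>
    (integrableOn_cpow_mul_exp_neg_succ_mul ha k).const_mul (c k)]
  simp_rw [MeasureTheory.integral_const_mul, integral_cpow_mul_exp_neg_succ_mul ha]

theorem sum_neg_one_pow_mul_choose_mul_pow_succ (n : ℕ) (u : ℂ) :
    ∑ k ∈ Finset.range (n + 1), (-1) ^ k * (n.choose k : ℂ) * u ^ (k + 1) = u * (1 - u) ^ n := by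
  rw [sub_eq_neg_add, add_pow, Finset.mul_sum]
  refine Finset.sum_congr rfl fun k _ => ?_
  rw [neg_pow u]
  ring

theorem sum_neg_one_pow_mul_choose_mul_succ_mul_pow (n : ℕ) (u : ℂ) :
    ∑ k ∈ Finset.range (n + 1), (-1) ^ k * (n.choose k : ℂ) * ((k : ℂ) + 1) * u ^ (k + 1) =
      u * (1 - u) ^ n - n * u ^ 2 * (1 - u) ^ (n - 1) := by
  have h1 : HasDerivAt (fun u : ℂ => u * (1 - u) ^ n)
      (∑ k ∈ Finset.range (n + 1), (-1) ^ k * (n.choose k : ℂ) * (((k + 1 : ℕ) : ℂ) * u ^ k)) u := by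
    simp_rw [← sum_neg_one_pow_mul_choose_mul_pow_succ]
    exact HasDerivAt.fun_sum fun k _ => (hasDerivAt_pow (k + 1) u).const_mul _
  have h2 : HasDerivAt (fun u : ℂ => u * (1 - u) ^ n)
      (1 * (1 - u) ^ n + u * (n * (1 - u) ^ (n - 1) * (-1))) u :=
    (hasDerivAt_id u).mul (((hasDerivAt_id u).const_sub 1).pow n)
  have h3 := congrArg (u * ·) (h1.unique h2)
  simp only [Finset.mul_sum] at h3
  convert! h3 using 1
  · refine Finset.sum_congr rfl fun k _ => ?_
    push_cast
    ring
  · ring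

theorem exp_neg_succ_mul (k : ℕ) (t : ℝ) :
    Complex.exp (-(((k : ℂ) + 1) * t)) = (Complex.exp (-t)) ^ (k + 1) := by
  rw [← Complex.exp_nat_mul]
  push_cast
  ring_nf

theorem integral_cpow_mul_exp_mul_one_sub_exp_pow {s : ℂ} (hs : 0 < s.re) (n : ℕ) :
    ∫ t : ℝ in Set.Ioi 0, (t : ℂ) ^ (s - 1) *
        (Complex.exp (-t) * (1 - Complex.exp (-t)) ^ n) =
      Complex.Gamma s * binomialDirichletSum n s := by
  have h := integral_cpow_mul_sum_exp hs (fun k => (-1) ^ k * (n.choose k : ℂ)) (n + 1)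
  simp_rw [exp_neg_succ_mul, sum_neg_one_pow_mul_choose_mul_pow_succ] at h
  exact h

theorem integrableOn_cpow_mul_exp_mul_one_sub_exp_pow {s : ℂ} (hs : 0 < s.re) (n : ℕ) :
    MeasureTheory.IntegrableOn (fun t : ℝ => (t : ℂ) ^ (s - 1) *
        (Complex.exp (-t) * (1 - Complex.exp (-t)) ^ n)) (Set.Ioi 0) := by
  have h := integrableOn_cpow_mul_sum_exp hs (fun k => (-1) ^ k * (n.choose k : ℂ)) (n + 1)
  simp_rw [exp_neg_succ_mul, sum_neg_one_pow_mul_choose_mul_pow_succ] at h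
  exact h

theorem Gamma_succ_mul_binomialDirichletSum {s : ℂ} (hs : -1 < s.re) (n : ℕ) :
    Complex.Gamma (s + 1) * binomialDirichletSum n s =
      ∫ t : ℝ in Set.Ioi 0, (t : ℂ) ^ s *
        (Complex.exp (-t) * (1 - Complex.exp (-t)) ^ n -
          n * Complex.exp (-t) ^ 2 * (1 - Complex.exp (-t)) ^ (n - 1)) := by
  have hs' : 0 < (s + 1).re := by simp; linarith
  have h := integral_cpow_mul_sum_exp hs'
    (fun k => (-1) ^ k * (n.choose k : ℂ) * ((k : ℂ) + 1)) (n + 1)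
  simp_rw [exp_neg_succ_mul, sum_neg_one_pow_mul_choose_mul_succ_mul_pow, add_sub_cancel_right] at h
  rw [h, binomialDirichletSum]
  congr 1
  refine Finset.sum_congr rfl fun k _ => ?_
  have hk : ((k : ℂ) + 1) ≠ 0 := Nat.cast_add_one_ne_zero k
  rw [mul_add (-_) s 1, Complex.exp_add, mul_one (-_), Complex.exp_neg (Complex.ofReal _),
    Complex.ofReal_log (by positivity)]
  push_cast
  rw [Complex.exp_log hk]
  field_simp

theorem abs_mul_one_sub_pow_sub_le (n : ℕ) {u : ℝ} (hu : u ∈ Set.Icc (0 : ℝ) 1) :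
    |u * (1 - u) ^ n - n * u ^ 2 * (1 - u) ^ (n - 1)| ≤
      2 * Real.exp 2 / √((n : ℝ) + 1) * √u := by
  obtain ⟨hu0, hu1⟩ := hu
  have hn : (0 : ℝ) ≤ n := Nat.cast_nonneg n
  have hv : 0 ≤ 1 - u := by linarith
  set p := (1 - u) ^ (n - 1) with hp
  have hp0 : 0 ≤ p := pow_nonneg hv _
  have hle : (1 - u) ^ n ≤ p := pow_le_pow_of_le_one hv (by linarith) (Nat.sub_le n 1)
  have hq0 : 0 ≤ (1 - u) ^ n := pow_nonneg hv _
  set w := ((n : ℝ) + 1) * u with hw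
  have hw0 : 0 ≤ w := by positivity
  have hpexp : p ≤ Real.exp 2 * Real.exp (-w) := by
    calc p ≤ (Real.exp (-u)) ^ (n - 1) :=
          pow_le_pow_left₀ hv (Real.one_sub_le_exp_neg u) _
      _ = Real.exp (-(((n - 1 : ℕ) : ℝ) * u)) := by rw [← Real.exp_nat_mul]; ring_nf
      _ ≤ Real.exp (2 + -w) := by
          apply Real.exp_le_exp.mpr
          have : (n : ℝ) ≤ ((n - 1 : ℕ) : ℝ) + 1 := by
            exact_mod_cast (by omega : n ≤ n - 1 + 1)
          nlinarith
      _ = _ := Real.exp_add _ _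
  have hsqrt : √w ≤ 1 + w := by
    rw [Real.sqrt_le_left (by positivity)]
    nlinarith
  have hquad : (1 + w) * (1 + w) ≤ 2 * Real.exp w := by
    nlinarith [Real.quadratic_le_exp_of_nonneg hw0]
  have hmain : √w * (p * (1 + n * u)) ≤ 2 * Real.exp 2 := by
    calc √w * (p * (1 + n * u)) ≤ (1 + w) * (Real.exp 2 * Real.exp (-w) * (1 + w)) := by
          gcongr
          nlinarith
      _ = Real.exp 2 * Real.exp (-w) * ((1 + w) * (1 + w)) := by ring
      _ ≤ Real.exp 2 * Real.exp (-w) * (2 * Real.exp w) := by gcongr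
      _ = 2 * Real.exp 2 * (Real.exp (-w) * Real.exp w) := by ring
      _ = 2 * Real.exp 2 := by rw [← Real.exp_add]; simp
  have hfirst : |u * (1 - u) ^ n - n * u ^ 2 * p| ≤ u * (p * (1 + n * u)) := by
    have h1 : 0 ≤ u * (1 - u) ^ n := by positivity
    have h2 : 0 ≤ n * u ^ 2 * p := by positivity
    have h3 : u * (1 - u) ^ n ≤ u * p := by gcongr
    rw [abs_le]
    constructor <;> nlinarith
  refine hfirst.trans ?_
  have hsn : 0 < √((n : ℝ) + 1) := by positivity
  rw [div_mul_eq_mul_div, le_div_iff₀ hsn]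
  rw [hw, Real.sqrt_mul (by positivity)] at hmain
  calc u * (p * (1 + n * u)) * √((n : ℝ) + 1)
      = √u * √u * (p * (1 + n * u)) * √((n : ℝ) + 1) := by rw [Real.mul_self_sqrt hu0]
    _ = √((n : ℝ) + 1) * √u * (p * (1 + n * u)) * √u := by ring
    _ ≤ _ := by gcongr

theorem norm_Gamma_succ_mul_binomialDirichletSum_le {s : ℂ} (hs : -1 < s.re) (n : ℕ) :
    ‖Complex.Gamma (s + 1) * binomialDirichletSum n s‖ ≤
      2 * Real.exp 2 / √((n : ℝ) + 1) * ((1 / (1 / 2)) ^ (s.re + 1) * Real.Gamma (s.re + 1)) := by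
  have hs' : 0 < s.re + 1 := by linarith
  have hint := Real.integral_rpow_mul_exp_neg_mul_Ioi hs' (r := 1 / 2) (by norm_num)
  rw [Gamma_succ_mul_binomialDirichletSum hs, ← hint, ← MeasureTheory.integral_const_mul]
  have hint' : MeasureTheory.IntegrableOn
      (fun t : ℝ => t ^ (s.re + 1 - 1) * Real.exp (-(1 / 2 * t))) (Set.Ioi 0) := by
    by_contra hcon
    rw [MeasureTheory.integral_undef hcon] at hint
    have : 0 < Real.Gamma (s.re + 1) := Real.Gamma_pos_of_pos hs'
    have : 0 < (1 / (1 / 2) : ℝ) ^ (s.re + 1) * Real.Gamma (s.re + 1) := by positivity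
    linarith
  refine MeasureTheory.norm_integral_le_of_norm_le (hint'.const_mul _) ?_
  refine MeasureTheory.ae_restrict_of_forall_mem measurableSet_Ioi fun t ht => ?_
  have ht0 : (0 : ℝ) < t := ht
  have hu : Real.exp (-t) ∈ Set.Icc (0 : ℝ) 1 :=
    ⟨(Real.exp_pos _).le, Real.exp_le_one_iff.mpr (by linarith)⟩
  have hbound := abs_mul_one_sub_pow_sub_le n hu
  have hsqrt : √(Real.exp (-t)) = Real.exp (-(1 / 2 * t)) := by
    rw [← Real.exp_half]
    ring_nf
  have hcast : Complex.exp (-t) * (1 - Complex.exp (-t)) ^ n -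
      n * Complex.exp (-t) ^ 2 * (1 - Complex.exp (-t)) ^ (n - 1) =
      ((Real.exp (-t) * (1 - Real.exp (-t)) ^ n -
        n * Real.exp (-t) ^ 2 * (1 - Real.exp (-t)) ^ (n - 1) : ℝ) : ℂ) := by
    push_cast
    ring
  rw [hcast, norm_mul, Complex.norm_cpow_eq_rpow_re_of_pos ht0, Complex.norm_real,
    Real.norm_eq_abs, add_sub_cancel_right, mul_left_comm]
  rw [hsqrt] at hbound
  gcongr

theorem exists_norm_binomialDirichletSum_le {K : Set ℂ} (hK : IsCompact K)
    (hre : ∀ s ∈ K, -1 < s.re) :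
    ∃ M : ℝ, ∀ s ∈ K, ∀ n : ℕ, ‖binomialDirichletSum n s‖ ≤ M / √((n : ℝ) + 1) := by
  have hcont : ContinuousOn (fun s : ℂ => 2 * Real.exp 2 *
      ((1 / (1 / 2)) ^ (s.re + 1) * Real.Gamma (s.re + 1)) / ‖Complex.Gamma (s + 1)‖) K := by
    intro s hs
    have hs1 : 0 < (s + 1).re := by
      have := hre s hs
      simp
      linarith
    have hs2 : 0 < s.re + 1 := by simpa using hs1
    have h1 : ContinuousAt (fun s : ℂ => Real.Gamma (s.re + 1)) s := by
      have : ContinuousAt Real.Gamma (s.re + 1) :=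
        (Real.differentiableAt_Gamma fun m => by
          have : (0 : ℝ) ≤ m := Nat.cast_nonneg m
          linarith).continuousAt
      exact ContinuousAt.comp (f := fun s : ℂ => s.re + 1) this (by fun_prop)
    have h2 : ContinuousAt (fun s : ℂ => Complex.Gamma (s + 1)) s := by
      have : ContinuousAt Complex.Gamma (s + 1) :=
        (Complex.differentiableAt_Gamma _ fun m h => by
          have : (0 : ℝ) ≤ m := Nat.cast_nonneg m
          rw [h] at hs1
          simp at hs1
          linarith).continuousAt
      exact ContinuousAt.comp (f := fun s : ℂ => s + 1) this (by fun_prop)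
    have h3 : ContinuousAt (fun s : ℂ => (1 / (1 / 2) : ℝ) ^ (s.re + 1)) s :=
      ((Real.continuous_const_rpow (by norm_num)).comp
        (Complex.continuous_re.add continuous_const)).continuousAt
    have h4 : ‖Complex.Gamma (s + 1)‖ ≠ 0 :=
      norm_ne_zero_iff.mpr (Complex.Gamma_ne_zero_of_re_pos hs1)
    exact ((continuousAt_const.mul (h3.mul h1)).div h2.norm h4).continuousWithinAt
  obtain ⟨M, hM⟩ := hK.exists_bound_of_continuousOn hcont
  refine ⟨M, fun s hs n => ?_⟩
  have hs1 : 0 < (s + 1).re := by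
    have := hre s hs
    simp
    linarith
  have hG : 0 < ‖Complex.Gamma (s + 1)‖ :=
    norm_pos_iff.mpr (Complex.Gamma_ne_zero_of_re_pos hs1)
  have hbound := norm_Gamma_succ_mul_binomialDirichletSum_le (hre s hs) n
  rw [norm_mul] at hbound
  have hle := (Real.le_norm_self _).trans (hM s hs)
  rw [div_le_iff₀ hG] at hle
  have hsn : 0 < √((n : ℝ) + 1) := by positivity
  rw [le_div_iff₀ hsn]
  refine le_of_mul_le_mul_right ?_ hG
  refine le_trans ?_ hle
  rw [div_mul_eq_mul_div, le_div_iff₀ hsn] at hbound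
  linarith

theorem exists_summable_norm_gregory_le {K : Set ℂ} (hK : IsCompact K)
    (hre : ∀ s ∈ K, -1 < s.re) :
    ∃ v : ℕ → ℝ, Summable v ∧ ∀ n, ∀ s ∈ K,
      ‖Complex.ofReal |gregoryG (n + 1)| * binomialDirichletSum n s‖ ≤ v n := by
  obtain ⟨M, hM⟩ := exists_norm_binomialDirichletSum_le hK hre
  refine ⟨fun n => M * (1 / ((n : ℝ) + 1) ^ (3 / 2 : ℝ)), ?_, fun n s hs => ?_⟩
  · have h := (Real.summable_one_div_nat_rpow (p := 3 / 2)).mpr (by norm_num)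
    have h' := (summable_nat_add_iff 1).mpr h
    push_cast at h'
    exact h'.mul_left M
  · rw [norm_mul, Complex.norm_real, Real.norm_eq_abs, abs_abs]
    have hn : (0 : ℝ) < (n : ℝ) + 1 := by positivity
    have hpow : ((n : ℝ) + 1) ^ (3 / 2 : ℝ) = ((n : ℝ) + 1) * √((n : ℝ) + 1) := by
      rw [Real.sqrt_eq_rpow, show (3 / 2 : ℝ) = 1 + 1 / 2 by norm_num, Real.rpow_add hn,
        Real.rpow_one]
    calc _ ≤ 1 / ((n : ℝ) + 1) * (M / √((n : ℝ) + 1)) :=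
          mul_le_mul (abs_gregoryG_succ_le n) (hM s hs n) (norm_nonneg _) (by positivity)
      _ = M * (1 / ((n : ℝ) + 1) ^ (3 / 2 : ℝ)) := by
          rw [hpow]
          field_simp

theorem integral_cpow_mul_exp_div_one_sub_exp {s : ℂ} (hs : 1 < s.re) :
    ∫ t : ℝ in Set.Ioi 0, (t : ℂ) ^ (s - 1) * (Complex.exp (-t) / (1 - Complex.exp (-t))) =
      Complex.Gamma s * riemannZeta s := by
  have h := hasSum_mellin (ι := ℕ) (a := fun _ => 1) (p := fun n => (n : ℝ) + 1)
    (F := fun t : ℝ => Complex.exp (-t) / (1 - Complex.exp (-t))) (s := s)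
    (fun n => Or.inr (by positivity)) (by linarith) (fun t ht => ?_) ?_
  · have h2 := h.tsum_eq
    rw [mellin] at h2
    simp only [smul_eq_mul] at h2
    rw [← h2, zeta_eq_tsum_one_div_nat_add_one_cpow hs, ← tsum_mul_left]
    refine tsum_congr fun n => ?_
    push_cast
    ring
  · have hnorm : ‖Complex.exp (-t)‖ < 1 := by
      rw [Complex.norm_exp]
      have ht0 : (0 : ℝ) < t := ht
      simpa using ht0
    have := (hasSum_geometric_of_norm_lt_one hnorm).mul_left (Complex.exp (-t))
    convert! this using 1
    ext n
    rw [← pow_succ', ← exp_neg_succ_mul]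
    push_cast
    ring_nf
  · have := (summable_nat_add_iff 1).mpr (Real.summable_one_div_nat_rpow.mpr hs)
    simpa using this

theorem integrableOn_cpow_mul_exp_div_one_sub_exp {s : ℂ} (hs : 1 < s.re) :
    MeasureTheory.IntegrableOn (fun t : ℝ =>
      (t : ℂ) ^ (s - 1) * (Complex.exp (-t) / (1 - Complex.exp (-t)))) (Set.Ioi 0) := by
  by_contra hcon
  have h := integral_cpow_mul_exp_div_one_sub_exp hs
  rw [MeasureTheory.integral_undef hcon] at h
  exact mul_ne_zero (Complex.Gamma_ne_zero_of_re_pos (by linarith))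
    (riemannZeta_ne_zero_of_one_lt_re hs) h.symm

theorem hasSum_abs_gregoryG_mul_exp {t : ℝ} (ht : 0 < t) :
    HasSum (fun n : ℕ => Complex.ofReal |gregoryG (n + 1)| *
        (Complex.exp (-t) * (1 - Complex.exp (-t)) ^ n))
      (Complex.exp (-t) / (1 - Complex.exp (-t)) - Complex.exp (-t) / t) := by
  have hx : 1 - Real.exp (-t) ∈ Set.Ioo (0 : ℝ) 1 := by
    have h1 := Real.exp_pos (-t)
    have h2 : Real.exp (-t) < 1 := Real.exp_lt_one_iff.mpr (by linarith)
    constructor <;> linarith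
  have h := (hasSum_abs_gregoryG_succ_mul_pow hx).mul_left (Real.exp (-t))
  rw [sub_sub_cancel, Real.log_exp] at h
  have h' := Complex.hasSum_ofReal.mpr h
  convert! h' using 1
  · ext n
    push_cast
    ring
  · push_cast
    rw [one_div (-(t : ℂ)), inv_neg]
    ring

theorem hasSum_gregory_of_one_lt_re {s : ℂ} (hs : 1 < s.re) :
    HasSum (fun n : ℕ => Complex.ofReal |gregoryG (n + 1)| * binomialDirichletSum n s)
      (riemannZeta s - 1 / (s - 1)) := by
  have hs0 : 0 < s.re := by linarith
  have hs1 : 0 < (s - 1).re := by simpa using hs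
  have hG : Complex.Gamma s ≠ 0 := Complex.Gamma_ne_zero_of_re_pos hs0
  set F : ℕ → ℝ → ℂ := fun n t => Complex.ofReal |gregoryG (n + 1)| * ((t : ℂ) ^ (s - 1) *
    (Complex.exp (-t) * (1 - Complex.exp (-t)) ^ n)) with hF
  have hint : ∀ n, MeasureTheory.IntegrableOn (F n) (Set.Ioi 0) := fun n =>
    (integrableOn_cpow_mul_exp_mul_one_sub_exp_pow hs0 n).const_mul _
  have hintegral : ∀ n, ∫ t in Set.Ioi 0, F n t =
      Complex.Gamma s * (Complex.ofReal |gregoryG (n + 1)| * binomialDirichletSum n s) := by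
    intro n
    rw [MeasureTheory.integral_const_mul, integral_cpow_mul_exp_mul_one_sub_exp_pow hs0]
    ring
  have hnorm : ∀ n, ∫ t in Set.Ioi 0, ‖F n t‖ = ‖Complex.Gamma s.re *
      (Complex.ofReal |gregoryG (n + 1)| * binomialDirichletSum n s.re)‖ := by
    intro n
    have hreal : ∫ t : ℝ in Set.Ioi 0, ((‖F n t‖ : ℝ) : ℂ) = Complex.Gamma s.re *
        (Complex.ofReal |gregoryG (n + 1)| * binomialDirichletSum n s.re) := by
      have h := integral_cpow_mul_exp_mul_one_sub_exp_pow (s := (s.re : ℂ)) (by simpa using hs0) n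
      rw [mul_left_comm, ← h, ← MeasureTheory.integral_const_mul]
      refine MeasureTheory.setIntegral_congr_fun measurableSet_Ioi fun t ht => ?_
      have ht0 : (0 : ℝ) < t := ht
      have hx : 0 ≤ 1 - Real.exp (-t) := by
        have : Real.exp (-t) ≤ 1 := Real.exp_le_one_iff.mpr (by linarith)
        linarith
      have hcast : Complex.exp (-t) * (1 - Complex.exp (-t)) ^ n =
          ((Real.exp (-t) * (1 - Real.exp (-t)) ^ n : ℝ) : ℂ) := by
        push_cast
        rfl
      simp only [hF]
      rw [hcast, norm_mul, norm_mul, Complex.norm_real, Complex.norm_real, Real.norm_eq_abs,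
        abs_abs, Complex.norm_cpow_eq_rpow_re_of_pos ht0, Real.norm_of_nonneg (by positivity)]
      push_cast
      rw [Complex.ofReal_cpow ht0.le]
      simp
    rw [← hreal, integral_complex_ofReal, Complex.norm_real, Real.norm_of_nonneg]
    exact MeasureTheory.integral_nonneg fun t => norm_nonneg _
  have hsum : Summable fun n => ∫ t in Set.Ioi 0, ‖F n t‖ := by
    obtain ⟨v, hv, hle⟩ := exists_summable_norm_gregory_le (K := {(s.re : ℂ)}) isCompact_singleton
      (by simp; linarith)
    simp_rw [hnorm, norm_mul (Complex.Gamma _)]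
    exact (Summable.of_nonneg_of_le (fun n => norm_nonneg _) (fun n => hle n _ rfl) hv).mul_left _
  have h := MeasureTheory.hasSum_integral_of_summable_integral_norm hint hsum
  have hlimit : ∫ t in Set.Ioi 0, ∑' n, F n t =
      Complex.Gamma s * (riemannZeta s - 1 / (s - 1)) := by
    have h1 := Complex.GammaIntegral_convergent hs1
    have h2 : ∫ t in Set.Ioi 0, ∑' n, F n t = ∫ t : ℝ in Set.Ioi 0,
        ((t : ℂ) ^ (s - 1) * (Complex.exp (-t) / (1 - Complex.exp (-t))) -
          ((-t).exp : ℂ) * (t : ℂ) ^ (s - 1 - 1)) := by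
      refine MeasureTheory.setIntegral_congr_fun measurableSet_Ioi fun t ht => ?_
      have ht0 : (t : ℂ) ≠ 0 := Complex.ofReal_ne_zero.mpr (ne_of_gt ht)
      have h3 := ((hasSum_abs_gregoryG_mul_exp ht).mul_left ((t : ℂ) ^ (s - 1))).tsum_eq
      simp only [hF, mul_left_comm (Complex.ofReal |gregoryG _|) ((t : ℂ) ^ (s - 1))]
      rw [h3, Complex.cpow_sub (s - 1) 1 ht0, Complex.cpow_one]
      push_cast
      ring
    rw [h2, MeasureTheory.integral_sub (integrableOn_cpow_mul_exp_div_one_sub_exp hs) h1,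
      integral_cpow_mul_exp_div_one_sub_exp hs]
    have h4 : s - 1 ≠ 0 := by
      intro h0
      rw [h0] at hs1
      simp at hs1
    have h5 : Complex.Gamma s = (s - 1) * Complex.Gamma (s - 1) := by
      rw [← Complex.Gamma_add_one _ h4, sub_add_cancel]
    have h6 := Complex.Gamma_eq_integral hs1
    rw [Complex.GammaIntegral] at h6
    rw [← h6, mul_sub]
    congr 1
    rw [h5]
    field_simp
  rw [hlimit] at h
  simp_rw [hintegral] at h
  exact (hasSum_mul_left_iff hG).mp h

theorem contDiff_binomialDirichletSum (n : ℕ) {r : WithTop ℕ∞} :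
    ContDiff ℂ r (binomialDirichletSum n) := by
  unfold binomialDirichletSum
  fun_prop

theorem iteratedDeriv_binomialDirichletSum_zero (n m : ℕ) :
    iteratedDeriv m (binomialDirichletSum n) 0 =
      (-1) ^ m * ∑ k ∈ Finset.range (n + 1), (-1) ^ k * (n.choose k : ℂ) *
        (Complex.ofReal (Real.log ((k : ℝ) + 1))) ^ m := by
  unfold binomialDirichletSum
  rw [iteratedDeriv_fun_sum fun k _ => by fun_prop, Finset.mul_sum]
  refine Finset.sum_congr rfl fun k _ => ?_
  rw [iteratedDeriv_const_mul_field, iteratedDeriv_cexp_const_mul]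
  simp only [mul_zero, Complex.exp_zero]
  rw [neg_pow]
  ring

theorem TendstoLocallyUniformlyOn.iteratedDeriv {ι : Type*} {φ : Filter ι} {F : ι → ℂ → ℂ}
    {f : ℂ → ℂ} {U : Set ℂ} (hf : TendstoLocallyUniformlyOn F f φ U)
    (hF : ∀ i, ContDiff ℂ ⊤ (F i)) (hU : IsOpen U) (m : ℕ) :
    TendstoLocallyUniformlyOn (fun i => iteratedDeriv m (F i)) (iteratedDeriv m f) φ U := by
  induction m with
  | zero => simpa using hf
  | succ m ih =>
    have h := ih.deriv (Eventually.of_forall fun i =>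
      ((hF i).differentiable_iteratedDeriv m (by simp)).differentiableOn) hU
    simpa only [iteratedDeriv_succ] using! h

theorem tendstoLocallyUniformlyOn_gregory {g : ℂ → ℂ} (hg : Differentiable ℂ g)
    (hgz : ∀ s : ℂ, s ≠ 1 → g s = riemannZeta s - 1 / (s - 1)) :
    TendstoLocallyUniformlyOn (fun N s => ∑ n ∈ Finset.range N,
      Complex.ofReal |gregoryG (n + 1)| * binomialDirichletSum n s) g atTop
      {s : ℂ | -1 < s.re} := by
  have hU : IsOpen {s : ℂ | -1 < s.re} := isOpen_lt continuous_const Complex.continuous_re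
  have hlim : TendstoLocallyUniformlyOn (fun N s => ∑ n ∈ Finset.range N,
      Complex.ofReal |gregoryG (n + 1)| * binomialDirichletSum n s)
      (fun s => ∑' n, Complex.ofReal |gregoryG (n + 1)| * binomialDirichletSum n s) atTop
      {s : ℂ | -1 < s.re} := by
    rw [tendstoLocallyUniformlyOn_iff_forall_isCompact hU]
    intro K hKU hK
    obtain ⟨v, hv, hle⟩ := exists_summable_norm_gregory_le hK hKU
    exact tendstoUniformlyOn_tsum_nat hv hle
  refine hlim.congr_right ?_
  have hdiff := hlim.differentiableOn (Eventually.of_forall fun N =>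
    (Differentiable.fun_sum fun n _ => ((contDiff_binomialDirichletSum n (r := 1)).differentiable
      one_ne_zero).const_mul _).differentiableOn) hU
  have hconn : IsPreconnected {s : ℂ | -1 < s.re} :=
    (convex_halfSpace_re_gt (-1)).isPreconnected
  refine (hdiff.analyticOnNhd hU).eqOn_of_preconnected_of_eventuallyEq
    (hg.differentiableOn.analyticOnNhd hU) hconn (z₀ := 2) (by norm_num) ?_
  have hnhds : {s : ℂ | 1 < s.re} ∈ nhds (2 : ℂ) :=
    (isOpen_lt continuous_const Complex.continuous_re).mem_nhds (by norm_num)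
  filter_upwards [hnhds] with s hs
  have hs1 : s ≠ 1 := by
    rintro rfl
    simp at hs
  rw [hgz s hs1, (hasSum_gregory_of_one_lt_re hs).tsum_eq]

/-- Series for the normalized Maclaurin coefficients `δ_m` of the regularized zeta function:
if `g` is the entire function agreeing with `ζ(s) − 1/(s−1)` away from `1`, then for `m ≥ 1`
the coefficient `δ_m = (−1)^m g^{(m)}(0)` satisfies
`δ_m = Σ_{n=0}^∞ |G_{n+1}| Σ_{k=0}^n (−1)^k C(n,k) (ln(k+1))^m`,
the outer series being convergent. -/
theorem maclaurin_delta_gregory_series (m : ℕ) (hm : 1 ≤ m) (g : ℂ → ℂ)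
    (hg : Differentiable ℂ g)
    (hgz : ∀ s : ℂ, s ≠ 1 → g s = riemannZeta s - 1 / (s - 1)) :
    ∃ L : ℂ,
      Tendsto (fun N : ℕ => ∑ n ∈ Finset.range N, (Complex.ofReal |gregoryG (n + 1)|) *
          ∑ k ∈ Finset.range (n + 1), (-1) ^ k * (n.choose k : ℂ) *
            (Complex.ofReal (Real.log ((k : ℝ) + 1))) ^ m)
        atTop (nhds L) ∧
      (-1) ^ m * iteratedDeriv m g 0 = L := by
  refine ⟨_, ?_, rfl⟩
  have hU : IsOpen {s : ℂ | -1 < s.re} := isOpen_lt continuous_const Complex.continuous_re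
  have h := ((tendstoLocallyUniformlyOn_gregory hg hgz).iteratedDeriv (fun N =>
    ContDiff.sum fun n _ => contDiff_const.mul (contDiff_binomialDirichletSum n)) hU m).tendsto_at
    (show (0 : ℂ) ∈ {s : ℂ | -1 < s.re} by simp)
  refine (h.const_mul ((-1) ^ m)).congr fun N => ?_
  rw [iteratedDeriv_fun_sum fun n _ =>
    (contDiff_const.mul (contDiff_binomialDirichletSum n)).contDiffAt, Finset.mul_sum]
  refine Finset.sum_congr rfl fun n _ => ?_
  rw [iteratedDeriv_const_mul_field, iteratedDeriv_binomialDirichletSum_zero, mul_left_comm,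
    ← mul_assoc ((-1) ^ m) ((-1) ^ m), ← mul_pow]
  simp
end
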